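/- arXiv:math/0504434 — 8 statements merged into one kernel-verified Lean document; each statement's English description precedes it below -/
import Mathlib

section
/- Let Λ be the even lattice U^{⊕3} ⊕ E8(−1)^{⊕2} ⊕ ⟨−2⟩, i.e. the free ℤ-module ℤ^23 equipped with the symmetric bilinear form whose Gram matrix is block diagonal with three hyperbolic blocks [[0,1],[1,0]], two copies of the negative of the E8 Cartan matrix, and the 1×1 block (−2). Then all vectors α ∈ Λ with (α,α) = 2 belong to a single orbit of the orthogonal group O(Λ): for any α₁, α₂ ∈ Λ with (α₁,α₁) = (α₂,α₂) = 2 there exists a ℤ-linear bijection g : Λ → Λ preserving the bilinear form such that g(α₁) = α₂. -/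
/- STATEMENT 0: all vectors of square 2 in the lattice
   Λ = U^{⊕3} ⊕ E8(−1)^{⊕2} ⊕ ⟨−2⟩ lie in one O(Λ)-orbit. -/

open Matrix

/-- The Gram matrix of Λ = U^{⊕3} ⊕ E8(−1)^{⊕2} ⊕ ⟨−2⟩ on ℤ^23: block diagonal with
three hyperbolic blocks `[[0,1],[1,0]]` (indices 0–5), two copies of the negative of the
E8 Cartan matrix (indices 6–13 and 14–21), and the 1×1 block `(−2)` (index 22). -/
def LambdaGram : Matrix (Fin 23) (Fin 23) ℤ := fun i j =>
  if i.val < 6 ∧ j.val < 6 then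
    (if i.val / 2 = j.val / 2 then (if i = j then 0 else 1) else 0)
  else if h2 : 6 ≤ i.val ∧ i.val < 14 ∧ 6 ≤ j.val ∧ j.val < 14 then
    - CartanMatrix.E₈ ⟨i.val - 6, by omega⟩ ⟨j.val - 6, by omega⟩
  else if h3 : 14 ≤ i.val ∧ i.val < 22 ∧ 14 ≤ j.val ∧ j.val < 22 then
    - CartanMatrix.E₈ ⟨i.val - 14, by omega⟩ ⟨j.val - 14, by omega⟩
  else if i.val = 22 ∧ j.val = 22 then -2
  else 0

/-- The symmetric bilinear form of the lattice Λ on ℤ^23. -/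
def lambdaForm (u v : Fin 23 → ℤ) : ℤ := u ⬝ᵥ (LambdaGram *ᵥ v)

namespace LinearMap.BilinForm

variable {L : Type*} [AddCommGroup L]

/-- Two vectors are in the same orbit of the isometry group of the bilinear form `B`. -/
def SameOrbit (B : LinearMap.BilinForm ℤ L) (v w : L) : Prop :=
  ∃ g : L ≃ₗ[ℤ] L, (∀ x y, B (g x) (g y) = B x y) ∧ g v = w

namespace SameOrbit

variable {B : LinearMap.BilinForm ℤ L} {u v w : L}

theorem refl (B : LinearMap.BilinForm ℤ L) (v : L) : SameOrbit B v v :=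
  ⟨LinearEquiv.refl ℤ L, fun _ _ => rfl, rfl⟩

theorem symm (h : SameOrbit B v w) : SameOrbit B w v := by
  obtain ⟨g, hg, rfl⟩ := h
  exact ⟨g.symm, fun x y => by simpa using (hg (g.symm x) (g.symm y)).symm, by simp⟩

theorem trans (h : SameOrbit B u v) (h' : SameOrbit B v w) : SameOrbit B u w := by
  obtain ⟨g, hg, rfl⟩ := h
  obtain ⟨g', hg', rfl⟩ := h'
  exact ⟨g.trans g', fun x y => by simp [hg, hg'], rfl⟩

theorem neg_right (h : SameOrbit B v w) : SameOrbit B v (-w) :=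
  h.trans ⟨LinearEquiv.neg ℤ, fun x y => by simp, rfl⟩

theorem apply_self_eq (h : SameOrbit B v w) : B w w = B v v := by
  obtain ⟨g, hg, rfl⟩ := h
  exact hg v v

theorem forall_dvd (h : SameOrbit B v w) {d : ℤ} (hd : ∀ x, d ∣ B w x) (x : L) :
    d ∣ B v x := by
  obtain ⟨g, hg, rfl⟩ := h
  exact hg v x ▸ hd (g x)

end SameOrbit

/-- The Eichler transvection attached to an isotropic vector `e` and a vector `a` orthogonal to
`e` of square `2 * c`. -/
def eichler (B : LinearMap.BilinForm ℤ L) (e a : L) (c : ℤ) : L →ₗ[ℤ] L :=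
  LinearMap.id + (B e).smulRight a - (B a).smulRight e - (c • B e).smulRight e

theorem eichler_apply (B : LinearMap.BilinForm ℤ L) (e a : L) (c : ℤ) (v : L) :
    eichler B e a c v = v + B e v • a - B a v • e - (c * B e v) • e := by
  simp [eichler]

theorem eichler_eichler_neg {B : LinearMap.BilinForm ℤ L} {e a : L} {c : ℤ}
    (hB : ∀ x y, B x y = B y x) (he : B e e = 0) (hea : B e a = 0) (ha : B a a = 2 * c) (v : L) :
    eichler B e a c (eichler B e (-a) c v) = v := by
  have hae : B a e = 0 := by rw [hB, hea]
  simp only [eichler_apply, map_add, map_sub, map_neg, map_smul, LinearMap.neg_apply, he, hea, hae,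
    ha]
  module

theorem sameOrbit_eichler {B : LinearMap.BilinForm ℤ L} {e a : L} {c : ℤ}
    (hB : ∀ x y, B x y = B y x) (he : B e e = 0) (hea : B e a = 0) (ha : B a a = 2 * c) (v : L) :
    SameOrbit B v (v + B e v • a - B a v • e - (c * B e v) • e) := by
  refine ⟨LinearEquiv.ofLinearMap (eichler B e a c) (eichler B e (-a) c) ?_ ?_, fun x y => ?_,
    eichler_apply B e a c v⟩
  · ext v
    exact eichler_eichler_neg hB he hea ha v
  · ext v
    simpa using eichler_eichler_neg (a := -a) hB he (by simpa using hea) (by simpa using ha) v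
  · have hae : B a e = 0 := by rw [hB, hea]
    simp only [LinearEquiv.coe_ofLinearMap, eichler_apply, map_add, map_sub, map_smul,
      LinearMap.add_apply, LinearMap.sub_apply, LinearMap.smul_apply, he, hea, hae, ha,
      smul_eq_mul, hB x e, hB x a]
    ring

/-- Two vectors `e`, `f` spanning a hyperbolic plane. -/
structure IsHyperbolicPair (B : LinearMap.BilinForm ℤ L) (e f : L) : Prop where
  left : B e e = 0
  right : B f f = 0
  cross : B e f = 1

section Eichler

variable {B : LinearMap.BilinForm ℤ L} {e f e' f' : L}

/-- The coordinate along `e` after an Eichler transvection along `f`, then one along `e`. -/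
theorem exists_sameOrbit_apply_eq (hB : ∀ x y, B x y = B y x) (h : IsHyperbolicPair B e f)
    {a b : L} {α β : ℤ} (hea : B e a = 0) (hfa : B f a = 0) (heb : B e b = 0) (hfb : B f b = 0)
    (ha : B a a = 2 * α) (hb : B b b = 2 * β) (v : L) :
    ∃ w, SameOrbit B v w ∧
      B f w = B f v - B b v - B f v * B b a - β * (B e v - B a v - α * B f v) := by
  refine ⟨_, (sameOrbit_eichler hB h.right hfa ha v).trans
    (sameOrbit_eichler hB h.left heb hb _), ?_⟩
  have hfe : B f e = 1 := by rw [hB, h.cross]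
  have hbf : B b f = 0 := by rw [hB, hfb]
  simp only [map_add, map_sub, map_smul, smul_eq_mul, h.right, h.cross, hfe, hea, hfa, hfb,
    hbf]
  ring

/-- Minimality of the coordinate `B f v` within the orbit of `v`: the coordinates of the other
vectors that are reduced modulo it vanish. -/
def IsReducedAt (B : LinearMap.BilinForm ℤ L) (f v : L) : Prop :=
  ∀ w, SameOrbit B v w → B f w % B f v = B f w → B f w = 0

theorem exists_sameOrbit_isReducedAt (B : LinearMap.BilinForm ℤ L) (f v : L) :
    ∃ w, SameOrbit B v w ∧ IsReducedAt B f w := by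
  by_cases h : ∃ w, SameOrbit B v w ∧ B f w ≠ 0
  · obtain ⟨w, ⟨hw, hw0⟩, hmin⟩ :=
      (measure fun w => (B f w).natAbs).wf.has_min {w | SameOrbit B v w ∧ B f w ≠ 0} h
    refine ⟨w, hw, fun u hu hmod => ?_⟩
    by_contra hu0
    refine hmin u ⟨hw.trans hu, hu0⟩ ?_
    have h₁ := Int.emod_nonneg (B f u) hw0
    have h₂ := Int.emod_lt_abs (B f u) hw0
    rw [hmod] at h₁ h₂
    rw [Int.abs_eq_natAbs] at h₂
    change (B f u).natAbs < (B f w).natAbs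
    omega
  · push Not at h
    exact ⟨v, SameOrbit.refl B v, fun u hu _ => h u hu⟩

theorem IsReducedAt.dvd {f v : L} (hv : IsReducedAt B f v) (X : ℤ)
    (h : ∀ k, ∃ w, SameOrbit B v w ∧ B f w = X + B f v * k) : B f v ∣ X := by
  obtain ⟨w, hw, hfw⟩ := h (-(X / B f v))
  have hmod : B f w = X % B f v := by
    rw [hfw, Int.emod_def]
    ring
  refine Int.dvd_of_emod_eq_zero ?_
  rw [← hmod]
  exact hv w hw (by rw [hmod, Int.emod_emod])

theorem IsReducedAt.dvd_apply_of_isotropic (hB : ∀ x y, B x y = B y x)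
    (heven : ∀ x, Even (B x x)) (h : IsHyperbolicPair B e f) {v z z' : L}
    (hv : IsReducedAt B f v) (hez : B e z = 0) (hfz : B f z = 0) (hez' : B e z' = 0)
    (hfz' : B f z' = 0) (hz : B z z = 0) (hzz' : B z z' = 1) : B f v ∣ B z v := by
  rw [← dvd_neg]
  refine hv.dvd _ fun k => ?_
  obtain ⟨c, hc⟩ := (heven ((1 - k) • z')).two_dvd
  obtain ⟨w, hw, hfw⟩ := exists_sameOrbit_apply_eq (a := (1 - k) • z') (b := z) (β := 0) hB h
    (by simp [hez']) (by simp [hfz']) hez hfz hc (by simp [hz]) v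
  refine ⟨w, hw, hfw.trans ?_⟩
  simp only [map_smul, hzz', smul_eq_mul]
  ring

/-- A vector which is reduced at one isotropic vector of a double hyperbolic plane pairs with the
whole lattice in multiples of the reduced coordinate. -/
theorem IsReducedAt.dvd_apply (hB : ∀ x y, B x y = B y x) (heven : ∀ x, Even (B x x))
    (h : IsHyperbolicPair B e f) (h' : IsHyperbolicPair B e' f') (hee' : B e e' = 0)
    (hef' : B e f' = 0) (hfe' : B f e' = 0) (hff' : B f f' = 0) {v : L}
    (hv : IsReducedAt B f v) (w : L) : B f v ∣ B v w := by
  have hfe : B f e = 1 := by rw [hB, h.cross]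
  have hf'e' : B f' e' = 1 := by rw [hB, h'.cross]
  have hdvd_e' : B f v ∣ B e' v :=
    hv.dvd_apply_of_isotropic hB heven h hee' hfe' hef' hff' h'.left h'.cross
  have hdvd_f' : B f v ∣ B f' v :=
    hv.dvd_apply_of_isotropic hB heven h hef' hff' hee' hfe' h'.right hf'e'
  have hdvd_e : B f v ∣ B e v := by
    obtain ⟨s, hs⟩ := hdvd_e'
    obtain ⟨t, ht⟩ := hdvd_f'
    rw [← dvd_neg]
    refine hv.dvd _ fun k => ?_
    obtain ⟨w, hw, hfw⟩ := exists_sameOrbit_apply_eq (a := (2 - t) • e' + (k + 1 - s + s * t) • f')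
      (b := e' + f') (α := (2 - t) * (k + 1 - s + s * t)) (β := 1) hB h
      (by simp [hee', hef']) (by simp [hfe', hff']) (by simp [hee', hef']) (by simp [hfe', hff'])
      (by
        simp only [map_add, map_smul, LinearMap.add_apply, LinearMap.smul_apply, smul_eq_mul,
          h'.left, h'.right, h'.cross, hf'e']
        ring)
      (by simp [h'.left, h'.right, h'.cross, hf'e']) v
    refine ⟨w, hw, hfw.trans ?_⟩
    simp only [map_add, map_smul, LinearMap.add_apply, LinearMap.smul_apply, smul_eq_mul,
      h'.left, h'.right, h'.cross, hf'e', hs, ht]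
    ring
  have hdvd_orth : ∀ a, B e a = 0 → B f a = 0 → B e' a = 0 → B f' a = 0 → B f v ∣ B a v := by
    intro a hea hfa he'a hf'a
    have hae' : B a e' = 0 := by rw [hB, he'a]
    have haf' : B a f' = 0 := by rw [hB, hf'a]
    obtain ⟨c, hc⟩ := (heven a).two_dvd
    have := hv.dvd_apply_of_isotropic (z := e' + a - c • f') (z' := f') hB heven h
      (by simp [hee', hea, hef']) (by simp [hfe', hfa, hff']) hef' hff'
      (by
        simp only [map_add, map_sub, map_smul, LinearMap.add_apply, LinearMap.sub_apply,
          LinearMap.smul_apply, smul_eq_mul, h'.left, h'.right, h'.cross, hf'e', hae', haf', he'a,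
          hf'a, hc]
        ring)
      (by simp [h'.cross, haf', h'.right])
    simp only [map_add, map_sub, map_smul, LinearMap.add_apply, LinearMap.sub_apply,
      LinearMap.smul_apply, smul_eq_mul] at this
    rw [show B a v = B e' v + B a v - c * B f' v + c * B f' v - B e' v by ring]
    exact dvd_sub (dvd_add this (hdvd_f'.mul_left c)) hdvd_e'
  have hdecomp := hdvd_orth
    (w - B f w • e - B e w • f - B f' w • e' - B e' w • f')
    (by simp [h.left, h.cross, hee', hef'])
    (by simp [h.right, hfe, hfe', hff'])
    (by simp [h'.left, h'.cross, hB e' e, hB e' f, hee', hfe'])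
    (by simp [h'.right, hf'e', hB f' e, hB f' f, hef', hff'])
  simp only [map_sub, map_smul, LinearMap.sub_apply, LinearMap.smul_apply, smul_eq_mul] at hdecomp
  rw [hB v w, show B w v = B w v - B f w * B e v - B e w * B f v - B f' w * B e' v -
    B e' w * B f' v + B f w * B e v + B e w * B f v + B f' w * B e' v + B e' w * B f' v by ring]
  exact dvd_add (dvd_add (dvd_add (dvd_add hdecomp (hdvd_e.mul_left (B f w)))
    ((dvd_refl (B f v)).mul_left (B e w))) (hdvd_e'.mul_left (B f' w))) (hdvd_f'.mul_left (B e' w))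

/-- A vector with coordinate `1` along `e` can be moved into the hyperbolic plane. -/
theorem exists_sameOrbit_of_apply_eq_one (hB : ∀ x y, B x y = B y x)
    (heven : ∀ x, Even (B x x)) (h : IsHyperbolicPair B e f) {v : L} (hv : B f v = 1) :
    ∃ c : ℤ, SameOrbit B v (e + c • f) := by
  have hfe : B f e = 1 := by rw [hB, h.cross]
  set n := v - e - B e v • f with hn
  obtain ⟨c, hc⟩ := (heven (-n)).two_dvd
  refine ⟨B e v + B n v - c, ?_⟩
  convert sameOrbit_eichler hB h.right (by simp [hn, hv, hfe, h.right]) hc v using 1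
  rw [hv, map_neg, LinearMap.neg_apply]
  simp only [hn]
  module

/-- **Eichler's criterion** for vectors of divisibility one in an even lattice containing two
orthogonal hyperbolic planes. -/
theorem sameOrbit_add_smul_of_dvd_isUnit (hB : ∀ x y, B x y = B y x)
    (heven : ∀ x, Even (B x x)) (h : IsHyperbolicPair B e f) (h' : IsHyperbolicPair B e' f')
    (hee' : B e e' = 0) (hef' : B e f' = 0) (hfe' : B f e' = 0) (hff' : B f f' = 0) {v : L}
    (hv : ∀ d : ℤ, (∀ w, d ∣ B v w) → IsUnit d) {c : ℤ} (hc : B v v = 2 * c) :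
    SameOrbit B v (e + c • f) := by
  obtain ⟨w, hw, hred⟩ := exists_sameOrbit_isReducedAt B f v
  have hunit : IsUnit (B f w) :=
    hv _ (hw.forall_dvd (hred.dvd_apply hB heven h h' hee' hef' hfe' hff'))
  obtain ⟨u, hu, hfu⟩ : ∃ u, SameOrbit B v u ∧ B f u = 1 := by
    rcases Int.isUnit_iff.mp hunit with h₁ | h₁
    · exact ⟨w, hw, h₁⟩
    · exact ⟨-w, hw.neg_right, by simp [h₁]⟩
  obtain ⟨k, hk⟩ := exists_sameOrbit_of_apply_eq_one hB heven h hfu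
  have hvk := hu.trans hk
  have hfe : B f e = 1 := by rw [hB, h.cross]
  have hself := hvk.apply_self_eq
  simp only [map_add, map_smul, LinearMap.add_apply, LinearMap.smul_apply, smul_eq_mul, h.left,
    h.right, h.cross, hfe, hc] at hself
  obtain rfl : k = c := by linarith
  exact hvk

end Eichler

end LinearMap.BilinForm

theorem lambdaGram_transpose (i j : Fin 23) : LambdaGram i j = LambdaGram j i := by
  have h : ∀ p : Fin 23 × Fin 23, LambdaGram p.1 p.2 = LambdaGram p.2 p.1 := by decide +kernel
  exact h (i, j)

theorem even_lambdaGram_diag (i : Fin 23) : Even (LambdaGram i i) := by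
  revert i
  decide +kernel

theorem toBilin'_lambdaGram (u v : Fin 23 → ℤ) :
    Matrix.toBilin' LambdaGram u v = lambdaForm u v :=
  Matrix.toBilin'_apply' _ _ _

theorem lambdaForm_comm (u v : Fin 23 → ℤ) : lambdaForm u v = lambdaForm v u := by
  have hT : LambdaGramᵀ = LambdaGram := Matrix.ext fun i j => lambdaGram_transpose j i
  rw [lambdaForm, lambdaForm, Matrix.dotProduct_mulVec, dotProduct_comm, ← Matrix.mulVec_transpose,
    hT]

theorem even_lambdaForm_self (v : Fin 23 → ℤ) : Even (lambdaForm v v) := by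
  simp only [← toBilin'_lambdaGram]
  have hB (x y : Fin 23 → ℤ) :
      Matrix.toBilin' LambdaGram x y = Matrix.toBilin' LambdaGram y x := by
    simp only [toBilin'_lambdaGram, lambdaForm_comm x y]
  induction v using Pi.single_induction with
  | zero => simp
  | add x y hx hy =>
    simp only [map_add, LinearMap.add_apply, hB y x]
    obtain ⟨a, ha⟩ := hx
    obtain ⟨b, hb⟩ := hy
    exact ⟨a + b + Matrix.toBilin' LambdaGram x y, by rw [ha, hb]; ring⟩
  | single i m =>
    have : (Pi.single i m : Fin 23 → ℤ) = m • Pi.single i 1 := by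
      rw [← Pi.single_smul, smul_eq_mul, mul_one]
    rw [this]
    simp only [map_smul, LinearMap.smul_apply, Matrix.toBilin'_single, smul_eq_mul]
    exact ((even_lambdaGram_diag i).mul_left m).mul_left m

set_option maxHeartbeats 4000000 in
theorem lambdaGram_mulVec (v : Fin 23 → ℤ) :
    LambdaGram *ᵥ v = ![v 1, v 0, v 3, v 2, v 5, v 4,
      -2 * v 6 + v 8, -2 * v 7 + v 9, v 6 - 2 * v 8 + v 9, v 7 + v 8 - 2 * v 9 + v 10,
      v 9 - 2 * v 10 + v 11, v 10 - 2 * v 11 + v 12, v 11 - 2 * v 12 + v 13, v 12 - 2 * v 13,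
      -2 * v 14 + v 16, -2 * v 15 + v 17, v 14 - 2 * v 16 + v 17, v 15 + v 16 - 2 * v 17 + v 18,
      v 17 - 2 * v 18 + v 19, v 18 - 2 * v 19 + v 20, v 19 - 2 * v 20 + v 21, v 20 - 2 * v 21,
      -2 * v 22] := by
  ext i
  fin_cases i <;>
    simp [LambdaGram, CartanMatrix.E₈, Matrix.mulVec, dotProduct, Fin.sum_univ_succ] <;> ring

/-- A vector pairing evenly with all of `Λ` has even coordinates outside the `⟨-2⟩` summand. -/
theorem exists_eq_two_smul_add_single {v : Fin 23 → ℤ} (hv : ∀ w, 2 ∣ lambdaForm v w) :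
    ∃ (x : Fin 23 → ℤ) (k : ℤ), v = (2 : ℤ) • x + k • Pi.single 22 1 := by
  have hrow (i : Fin 23) : 2 ∣ (LambdaGram *ᵥ v) i := by
    have := hv (Pi.single i 1)
    rwa [lambdaForm_comm, lambdaForm, single_one_dotProduct] at this
  rw [lambdaGram_mulVec] at hrow
  have heven (i : Fin 23) (hi : i ≠ 22) : 2 ∣ v i := by
    simp [Fin.forall_fin_succ] at hrow
    fin_cases i <;> first | exact absurd rfl hi | (simp; omega)
  refine ⟨fun i => if i = 22 then 0 else v i / 2, v 22, funext fun i => ?_⟩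
  by_cases hi : i = 22
  · subst hi
    simp
  · simp [hi, Int.mul_ediv_cancel' (heven i hi)]

theorem isUnit_of_forall_dvd_lambdaForm {v : Fin 23 → ℤ} (hv : lambdaForm v v = 2) {d : ℤ}
    (hd : ∀ w, d ∣ lambdaForm v w) : IsUnit d := by
  have hd2 : d ∣ 2 := hv ▸ hd v
  rcases (Nat.dvd_prime Nat.prime_two).mp (Int.natAbs_dvd_natAbs.mpr hd2) with h | h
  · exact Int.isUnit_iff_natAbs_eq.mpr h
  obtain ⟨x, k, rfl⟩ := exists_eq_two_smul_add_single fun w =>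
    (show 2 ∣ d by omega).trans (hd w)
  exfalso
  obtain ⟨m, hm⟩ := (even_lambdaForm_self x).two_dvd
  have hsingle (y : Fin 23 → ℤ) : lambdaForm (Pi.single 22 1) y = -2 * y 22 := by
    rw [lambdaForm, single_one_dotProduct, lambdaGram_mulVec]
    rfl
  have hx := lambdaForm_comm x (Pi.single 22 1)
  simp only [← toBilin'_lambdaGram] at hv hm hx hsingle
  simp only [map_add, map_smul, LinearMap.add_apply, LinearMap.smul_apply, smul_eq_mul, hm, hx,
    hsingle, Pi.single_eq_same] at hv
  have hk : k * k = 4 * (m - k * x 22) - 1 := by linarith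
  have hk4 : k * k % 4 = 3 := by omega
  rcases Int.emod_two_eq_zero_or_one k with h' | h' <;>
    obtain ⟨j, hj⟩ : ∃ j, k = 2 * j + k % 2 := ⟨k / 2, by omega⟩ <;>
    rw [h'] at hj <;> subst hj <;> ring_nf at hk4 <;> omega

theorem sameOrbit_lambdaForm {v : Fin 23 → ℤ} (hv : lambdaForm v v = 2) :
    LinearMap.BilinForm.SameOrbit (Matrix.toBilin' LambdaGram) v
      (Pi.single 0 1 + (1 : ℤ) • Pi.single 1 1) := by
  have hentry (i j : Fin 23) :
      Matrix.toBilin' LambdaGram (Pi.single i 1) (Pi.single j 1) = LambdaGram i j :=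
    Matrix.toBilin'_single _ _ _
  refine LinearMap.BilinForm.sameOrbit_add_smul_of_dvd_isUnit
    (e' := Pi.single 2 1) (f' := Pi.single 3 1) (fun x y => ?_) (fun x => ?_)
    ⟨?_, ?_, ?_⟩ ⟨?_, ?_, ?_⟩ ?_ ?_ ?_ ?_ (fun d hd => ?_) ?_
  · simpa only [toBilin'_lambdaGram] using lambdaForm_comm x y
  · simpa only [toBilin'_lambdaGram] using even_lambdaForm_self x
  all_goals first | (rw [hentry]; decide +kernel) | skip
  · exact isUnit_of_forall_dvd_lambdaForm hv (by simpa only [toBilin'_lambdaGram] using hd)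
  · rw [toBilin'_lambdaGram, hv, mul_one]

theorem square_two_vectors_single_orbit
    (α₁ α₂ : Fin 23 → ℤ)
    (h₁ : lambdaForm α₁ α₁ = 2) (h₂ : lambdaForm α₂ α₂ = 2) :
    ∃ g : (Fin 23 → ℤ) ≃ₗ[ℤ] (Fin 23 → ℤ),
      (∀ u v : Fin 23 → ℤ, lambdaForm (g u) (g v) = lambdaForm u v) ∧ g α₁ = α₂ := by
  obtain ⟨g, hg, hgα⟩ := (sameOrbit_lambdaForm h₁).trans (sameOrbit_lambdaForm h₂).symm
  exact ⟨g, fun u v => by simpa only [toBilin'_lambdaGram] using hg u v, hgα⟩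
end

section
/- Let F ∈ ℂ[X₀,…,X₅] be a nonzero homogeneous cubic vanishing identically on a 4-dimensional linear subspace Ω ⊂ ℂ⁶, so the cubic hypersurface Y = V(F) ⊂ ℙ⁵ contains the 3-dimensional projective linear space ℙ(Ω). Then there exists a 5-dimensional linear subspace Z ⊂ ℂ⁶ containing Ω such that either F vanishes identically on Z, or the restriction F|_Z factors as F|_Z = L·Q, where L is a linear form on Z with kernel Ω and Q is a quadratic form on Z of rank at most 4 (a singular quadric hypersurface in ℙ(Z)). In either case ℙ(Z) ∩ Y is swept out by planes: every point of ℙ(Z) ∩ Y lies on a plane contained in Y. -/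
/- STATEMENT 4: if a cubic hypersurface Y = V(F) ⊂ ℙ⁵ contains a 3-dimensional
projective linear space ℙ(Ω), then there is a hyperplane ℙ(Z) ⊇ ℙ(Ω) such that
ℙ(Z) ∩ Y is swept out by planes: either F vanishes on Z, or F|_Z = L·Q with
L a linear form with kernel Ω and Q a singular quadratic form (rank ≤ 4);
every point of ℙ(Z) ∩ Y lies on a plane contained in Y. -/

open MvPolynomial

/-- A nonzero binary form over `ℂ` of positive degree has a nontrivial zero; the form is given as a
homogeneous function that is holomorphic along affine lines. -/
lemma exists_nontrivial_zero_of_homogeneous {V : Type*} [AddCommGroup V] [Module ℂ V]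
    (f : V → ℂ) {n : ℕ} (hn : n ≠ 0) (hom : ∀ (s : ℂ) (v : V), f (s • v) = s ^ n * f v)
    (hd : ∀ u v : V, Differentiable ℂ fun s : ℂ => f (u + s • v)) (u v : V) :
    ∃ a b : ℂ, (a ≠ 0 ∨ b ≠ 0) ∧ f (a • u + b • v) = 0 := by
  by_contra! h
  have hg : ∀ s : ℂ, f (u + s • v) ≠ 0 := fun s => by simpa using h 1 s (by simp)
  have hv : f v ≠ 0 := by simpa using h 0 1 (by simp)
  have hdiff : Differentiable ℂ fun s : ℂ => (f (u + s • v))⁻¹ := (hd u v).inv hg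
  have hinv : Filter.Tendsto (fun s : ℂ => s⁻¹) (Filter.cocompact ℂ) (nhds 0) :=
    Metric.cobounded_eq_cocompact (α := ℂ) ▸ Filter.tendsto_inv₀_cobounded
  have hcont : Filter.Tendsto (fun s : ℂ => f (v + s⁻¹ • u)) (Filter.cocompact ℂ) (nhds (f v)) := by
    have := ((hd v u).continuous.tendsto 0).comp hinv
    simpa [Function.comp_def] using this
  have hlim : Filter.Tendsto (fun s : ℂ => (s⁻¹) ^ n * (f (v + s⁻¹ • u))⁻¹)
      (Filter.cocompact ℂ) (nhds 0) := by
    simpa [hn] using (hinv.pow n).mul (hcont.inv₀ hv)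
  have htend : Filter.Tendsto (fun s : ℂ => (f (u + s • v))⁻¹) (Filter.cocompact ℂ) (nhds 0) := by
    refine hlim.congr' ?_
    have hne : ∀ᶠ s : ℂ in Filter.cocompact ℂ, s ≠ 0 :=
      (isCompact_singleton (x := (0 : ℂ))).compl_mem_cocompact
    filter_upwards [hne] with s hs
    have : u + s • v = s • (v + s⁻¹ • u) := by
      rw [smul_add, smul_smul, mul_inv_cancel₀ hs, one_smul, add_comm]
    rw [this, hom, mul_inv, inv_pow]
  exact inv_ne_zero (hg 0) (hdiff.apply_eq_of_tendsto_cocompact 0 htend)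

lemma QuadraticMap.exists_nontrivial_zero {V : Type*} [AddCommGroup V] [Module ℂ V]
    (Q : QuadraticForm ℂ V) (u v : V) :
    ∃ a b : ℂ, (a ≠ 0 ∨ b ≠ 0) ∧ Q (a • u + b • v) = 0 := by
  refine exists_nontrivial_zero_of_homogeneous Q two_ne_zero
    (fun s v => by rw [QuadraticMap.map_smul, smul_eq_mul, pow_two]) (fun u v => ?_) u v
  simp only [QuadraticMap.map_add, QuadraticMap.map_smul, QuadraticMap.polar_smul_right,
    smul_eq_mul]
  fun_prop

lemma exists_totally_isotropic_of_linearIndependent {V : Type*} [AddCommGroup V] [Module ℂ V]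
    [FiniteDimensional ℂ V] (hV : 5 ≤ Module.finrank ℂ V) (Q : QuadraticForm ℂ V) {w y : V}
    (hw : ∀ z, QuadraticMap.polar Q w z = 0) (hy : Q y = 0) (hwy : LinearIndependent ℂ ![w, y]) :
    ∃ W : Submodule ℂ V, Module.finrank ℂ W = 3 ∧ w ∈ W ∧ y ∈ W ∧ ∀ z ∈ W, Q z = 0 := by
  have hQw : Q w = 0 := by
    have := hw w
    rw [QuadraticMap.polar_self] at this
    simpa using this
  let N : Submodule ℂ V := LinearMap.ker (Q.polarBilin y)
  have hN : 4 ≤ Module.finrank ℂ N := by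
    have h1 := (Q.polarBilin y).finrank_range_add_finrank_ker
    have h2 : Module.finrank ℂ (LinearMap.range (Q.polarBilin y)) ≤ 1 := by
      simpa using Submodule.finrank_le (LinearMap.range (Q.polarBilin y))
    change Module.finrank ℂ _ + Module.finrank ℂ N = _ at h1
    omega
  have hwN : w ∈ N := by
    change QuadraticMap.polar Q y w = 0
    rw [QuadraticMap.polar_comm, hw]
  have hyN : y ∈ N := by
    change QuadraticMap.polar Q y y = 0
    rw [QuadraticMap.polar_self, hy, smul_zero]
  have h2 : LinearIndependent ℂ ![(⟨w, hwN⟩ : N), ⟨y, hyN⟩] := by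
    refine LinearIndependent.of_comp N.subtype ?_
    convert hwy using 1
    ext i
    fin_cases i <;> rfl
  obtain ⟨p, hp⟩ := exists_linearIndependent_cons_of_lt_finrank h2 (by omega)
  obtain ⟨q, hq⟩ := exists_linearIndependent_cons_of_lt_finrank hp (by omega)
  obtain ⟨a, b, hab, hz⟩ := Q.exists_nontrivial_zero (p : V) q
  set z : V := a • (p : V) + b • (q : V) with hzdef
  have hyz : QuadraticMap.polar Q y z = 0 := (a • p + b • q).2
  have hli : LinearIndependent ℂ ![w, y, z] := by
    have hq' := hq.map' N.subtype N.ker_subtype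
    rw [Fintype.linearIndependent_iff] at hq' ⊢
    intro g hg
    have := hq' ![g 2 * b, g 2 * a, g 0, g 1] (by
      simp only [Fin.sum_univ_succ, Fin.sum_univ_zero] at hg ⊢
      simp at hg ⊢
      rw [← hg, hzdef]
      module)
    have h0 := this 0
    have h1 := this 1
    have h2 := this 2
    have h3 := this 3
    simp at h0 h1 h2 h3
    intro i
    fin_cases i
    · exact h2
    · exact h3
    · rcases hab with h | h
      · exact h1.resolve_right h
      · exact h0.resolve_right h
  refine ⟨Submodule.span ℂ (Set.range ![w, y, z]), by simpa using finrank_span_eq_card hli,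
    Submodule.subset_span ⟨0, rfl⟩, Submodule.subset_span ⟨1, rfl⟩, fun v hv => ?_⟩
  obtain ⟨c, rfl⟩ := (Submodule.mem_span_range_iff_exists_fun ℂ).1 hv
  rw [Fin.sum_univ_three]
  simp [QuadraticMap.map_add Q, QuadraticMap.map_smul, QuadraticMap.polar_smul_left,
    QuadraticMap.polar_smul_right, QuadraticMap.polar_add_left, hw, hyz, hQw, hy, hz]

/-- Every point of a singular quadric of projective dimension at least `3` lies on a plane contained
in the quadric. -/
lemma exists_totally_isotropic_of_singular {V : Type*} [AddCommGroup V] [Module ℂ V]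
    [FiniteDimensional ℂ V] (hV : 5 ≤ Module.finrank ℂ V) (Q : QuadraticForm ℂ V) {w y : V}
    (hw0 : w ≠ 0) (hw : ∀ z, QuadraticMap.polar Q w z = 0) (hy : Q y = 0) :
    ∃ W : Submodule ℂ V, Module.finrank ℂ W = 3 ∧ y ∈ W ∧ ∀ z ∈ W, Q z = 0 := by
  by_cases hwy : LinearIndependent ℂ ![w, y]
  · obtain ⟨W, h3, -, hyW, hW⟩ := exists_totally_isotropic_of_linearIndependent hV Q hw hy hwy
    exact ⟨W, h3, hyW, hW⟩
  · obtain ⟨c, rfl⟩ : ∃ c : ℂ, c • w = y := by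
      simpa [LinearIndependent.pair_iff' hw0] using hwy
    have h1 : LinearIndependent ℂ ![w] := by simpa using hw0
    obtain ⟨p, hp⟩ := exists_linearIndependent_cons_of_lt_finrank h1 (by omega)
    obtain ⟨q, hq⟩ := exists_linearIndependent_cons_of_lt_finrank hp (by omega)
    obtain ⟨a, b, hab, hz⟩ := Q.exists_nontrivial_zero p q
    have hli : LinearIndependent ℂ ![w, a • p + b • q] := by
      rw [Fintype.linearIndependent_iff] at hq ⊢
      intro g hg
      have := hq ![g 1 * b, g 1 * a, g 0] (by
        simp [Fin.sum_univ_succ] at hg ⊢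
        rw [← hg]
        module)
      have h0 := this 0
      have h1 := this 1
      have h2 := this 2
      simp at h0 h1 h2
      intro i
      fin_cases i
      · exact h2
      · rcases hab with h | h
        · exact h1.resolve_right h
        · exact h0.resolve_right h
    obtain ⟨W, h3, hwW, -, hW⟩ := exists_totally_isotropic_of_linearIndependent hV Q hw hz hli
    exact ⟨W, h3, W.smul_mem c hwW, hW⟩

/-- A cubic form is the diagonal restriction of a trilinear form. -/
lemma MvPolynomial.IsHomogeneous.exists_trilinear {σ R : Type*} [CommRing R]
    {F : MvPolynomial σ R} (hF : F.IsHomogeneous 3) :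
    ∃ T : (σ → R) →ₗ[R] (σ → R) →ₗ[R] (σ → R) →ₗ[R] R, ∀ x, T x x x = eval x F := by
  have key : ∀ d ∈ F.support, ∃ T : (σ → R) →ₗ[R] (σ → R) →ₗ[R] (σ → R) →ₗ[R] R,
      ∀ x, T x x x = ∏ i ∈ d.support, x i ^ d i := by
    intro d hd
    have hcard : Multiset.card (Finsupp.toMultiset d) = 3 := by
      rw [Finsupp.card_toMultiset, ← hF (mem_support_iff.1 hd)]
      exact DFunLike.congr_fun Finsupp.degree_eq_weight_one d
    obtain ⟨i, j, k, hijk⟩ := Multiset.card_eq_three.1 hcard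
    refine ⟨(LinearMap.proj i).smulRight ((LinearMap.proj j).smulRight (LinearMap.proj k)),
      fun x => ?_⟩
    have : (∏ i ∈ d.support, x i ^ d i) = ((Finsupp.toMultiset d).map x).prod := by
      rw [Finsupp.toMultiset_map, Finsupp.prod_toMultiset,
        Finsupp.prod_mapDomain_index pow_zero pow_add]
      rfl
    rw [this, hijk]
    simp
  choose! T hT using key
  refine ⟨∑ d ∈ F.support, coeff d F • T d, fun x => ?_⟩
  rw [eval_eq, LinearMap.sum_apply, LinearMap.sum_apply, LinearMap.sum_apply]
  exact Finset.sum_congr rfl fun d hd => by simp [hT d hd]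

section ResidualQuadric

variable {V : Type*} [AddCommGroup V] [Module ℂ V] (T : V →ₗ[ℂ] V →ₗ[ℂ] V →ₗ[ℂ] ℂ)

/-- The bilinear form `A` on `V × ℂ` with
`T (x + t • e) (x + t • e) (x + t • e) = T x x x + t * A (x, t) (x, t)`. -/
noncomputable def residualBilin (e : V) : LinearMap.BilinForm ℂ (V × ℂ) :=
  LinearMap.mk₂ ℂ
    (fun p q => T p.1 q.1 e + T p.1 e q.1 + T e p.1 q.1
      + p.2 * (T q.1 e e + T e q.1 e + T e e q.1) + p.2 * q.2 * T e e e)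
    (fun p p' q => by simp; ring) (fun c p q => by simp; ring)
    (fun p q q' => by simp; ring) (fun c p q => by simp; ring)

lemma residualBilin_apply (e : V) (p q : V × ℂ) :
    residualBilin T e p q = T p.1 q.1 e + T p.1 e q.1 + T e p.1 q.1
      + p.2 * (T q.1 e e + T e q.1 e + T e e q.1) + p.2 * q.2 * T e e e := rfl

/-- The vectors `(b i, 0)` followed by `(0, 1)`. -/
def residualFrame {ι : Type*} (b : ι → V) : ι ⊕ Unit → V × ℂ :=
  Sum.elim (fun i => (b i, 0)) fun _ => (0, 1)

/-- The symmetrized Gram matrix of `residualBilin T e`. -/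
noncomputable def residualMatrix {ι : Type*} (b : ι → V) (e : V) : Matrix (ι ⊕ Unit) (ι ⊕ Unit) ℂ :=
  Matrix.of fun i j => residualBilin T e (residualFrame b i) (residualFrame b j)
    + residualBilin T e (residualFrame b j) (residualFrame b i)

lemma det_residualMatrix_smul {ι : Type*} [Fintype ι] [DecidableEq ι] (b : ι → V) (s : ℂ) (e : V) :
    (residualMatrix T b (s • e)).det = s ^ (Fintype.card ι + 3) * (residualMatrix T b e).det := by
  have h : residualMatrix T b (s • e) =
      s • (Matrix.diagonal (Sum.elim (fun _ => 1) fun _ => s) * residualMatrix T b e *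
        Matrix.diagonal (Sum.elim (fun _ => 1) fun _ => s)) := by
    ext i j
    rw [Matrix.smul_apply, Matrix.mul_diagonal, Matrix.diagonal_mul]
    rcases i with i | i <;> rcases j with j | j <;>
      simp [residualMatrix, residualFrame, residualBilin_apply] <;> ring
  rw [h, Matrix.det_smul, Matrix.det_mul, Matrix.det_mul, Matrix.det_diagonal]
  simp
  ring

lemma differentiable_det_residualMatrix {ι : Type*} [Fintype ι] [DecidableEq ι] (b : ι → V)
    (u v : V) : Differentiable ℂ fun s : ℂ => (residualMatrix T b (u + s • v)).det := by
  simp only [Matrix.det_apply, residualMatrix, Matrix.of_apply, residualBilin_apply, map_add,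
    map_smul, LinearMap.add_apply, LinearMap.smul_apply, smul_eq_mul]
  fun_prop

end ResidualQuadric

/-- If the residual Gram matrix is degenerate, the hyperplane `Ω + ⟨e⟩` meets the cubic in `Ω` and a
singular quadric. -/
lemma exists_singular_residual_quadric {V : Type*} [AddCommGroup V] [Module ℂ V]
    (T : V →ₗ[ℂ] V →ₗ[ℂ] V →ₗ[ℂ] ℂ) {Ω : Submodule ℂ V} (hΩ : ∀ x ∈ Ω, T x x x = 0)
    {ι : Type*} [Fintype ι] [DecidableEq ι] (b : Module.Basis ι ℂ Ω) {e : V} (he : e ∉ Ω)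
    (hdet : (residualMatrix T (fun i => (b i : V)) e).det = 0) :
    ∃ (L : ↥(Ω ⊔ Submodule.span ℂ {e}) →ₗ[ℂ] ℂ)
      (Q : QuadraticForm ℂ ↥(Ω ⊔ Submodule.span ℂ {e})),
      LinearMap.ker L = Ω.comap (Ω ⊔ Submodule.span ℂ {e}).subtype ∧
      (∃ w, w ≠ 0 ∧ ∀ z, QuadraticMap.polar Q w z = 0) ∧
      ∀ z : ↥(Ω ⊔ Submodule.span ℂ {e}), T z z z = L z * Q z := by
  set Z := Ω ⊔ Submodule.span ℂ {e}
  obtain ⟨ℓ₀, hℓ₀e, hℓ₀⟩ := Submodule.exists_le_ker_of_notMem he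
  obtain ⟨ℓ, hℓe, hℓ⟩ : ∃ ℓ : V →ₗ[ℂ] ℂ, ℓ e = 1 ∧ ∀ x ∈ Ω, ℓ x = 0 :=
    ⟨(ℓ₀ e)⁻¹ • ℓ₀, by simp [hℓ₀e], fun x hx => by simp [LinearMap.mem_ker.1 (hℓ₀ hx)]⟩
  have hZ : ∀ z ∈ Z, z - ℓ z • e ∈ Ω := by
    intro z hz
    obtain ⟨x, hx, y, hy, rfl⟩ := Submodule.mem_sup.1 hz
    obtain ⟨t, rfl⟩ := Submodule.mem_span_singleton.1 hy
    simpa [hℓ x hx, hℓe] using hx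
  let ψ : V →ₗ[ℂ] V × ℂ := (LinearMap.id - ℓ.smulRight e).prod ℓ
  have hψ : ∀ z, ψ z = (z - ℓ z • e, ℓ z) := fun z => rfl
  let A := residualBilin T e
  refine ⟨ℓ ∘ₗ Z.subtype, (LinearMap.BilinMap.toQuadraticMap A).comp (ψ ∘ₗ Z.subtype), ?_, ?_, ?_⟩
  · ext z
    simp only [LinearMap.mem_ker, LinearMap.comp_apply, Submodule.mem_comap]
    refine ⟨fun h => ?_, fun h => hℓ _ h⟩
    have := hZ z z.2
    rw [Submodule.subtype_apply] at h ⊢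
    simpa [h] using this
  · obtain ⟨c, hc0, hc⟩ := Matrix.exists_mulVec_eq_zero_iff.2 hdet
    have hx : ∑ i, c (.inl i) • (b i : V) ∈ Ω :=
      Ω.sum_mem fun i _ => Ω.smul_mem _ (b i).2
    set x := ∑ i, c (.inl i) • (b i : V) with hxdef
    have hwZ : x + c (.inr ()) • e ∈ Z :=
      Submodule.add_mem_sup hx (Submodule.mem_span_singleton.2 ⟨_, rfl⟩)
    have hℓw : ℓ (x + c (.inr ()) • e) = c (.inr ()) := by simp [hℓ x hx, hℓe]
    have hψw : ψ (x + c (.inr ()) • e) = ∑ i, c i • residualFrame (fun i => (b i : V)) i := by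
      rw [hψ, hℓw]
      ext <;> simp [residualFrame, hxdef, Prod.fst_sum, Prod.snd_sum]
    let H : LinearMap.BilinForm ℂ (V × ℂ) := A + A.flip
    have hH : ∀ j, H (residualFrame (fun i => (b i : V)) j) (ψ (x + c (.inr ()) • e)) = 0 := by
      intro j
      rw [hψw, map_sum]
      refine Eq.trans ?_ (congrFun hc j)
      refine Finset.sum_congr rfl fun i _ => ?_
      rw [map_smul, smul_eq_mul, mul_comm]
      rfl
    have hHΩ : ∀ y ∈ Ω, H (y, 0) (ψ (x + c (.inr ()) • e)) = 0 := by
      have : (H.flip (ψ (x + c (.inr ()) • e))) ∘ₗ LinearMap.inl ℂ V ℂ ∘ₗ Ω.subtype = 0 :=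
        b.ext fun i => hH (.inl i)
      exact fun y hy => LinearMap.congr_fun this ⟨y, hy⟩
    refine ⟨⟨_, hwZ⟩, fun h => hc0 ?_, fun z => ?_⟩
    · have hw0 : x + c (.inr ()) • e = 0 := congrArg Subtype.val h
      have hr : c (.inr ()) = 0 := by rw [← hℓw, hw0, map_zero]
      have hsum : ∑ i, c (.inl i) • b i = 0 := by
        apply Subtype.ext
        simpa [hr, hxdef] using hw0
      ext (i | i)
      · exact Fintype.linearIndependent_iff.1 b.linearIndependent _ hsum i
      · exact hr
    · have hz : H (ψ z) (ψ (x + c (.inr ()) • e)) = 0 := by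
        have : ψ z = ((z : V) - ℓ z • e, 0) + ℓ z • residualFrame (fun i => (b i : V)) (.inr ()) := by
          simp [hψ, residualFrame]
        rw [this, map_add, map_smul, LinearMap.add_apply, LinearMap.smul_apply, hH,
          hHΩ _ (hZ z z.2), smul_zero, add_zero]
      have hz' : A (ψ z) (ψ (x + c (.inr ()) • e)) + A (ψ (x + c (.inr ()) • e)) (ψ z) = 0 := hz
      rw [add_comm] at hz'
      refine Eq.trans ?_ hz'
      simp only [QuadraticMap.polar, QuadraticMap.comp_apply, LinearMap.BilinMap.toQuadraticMap_apply,
        LinearMap.comp_apply, Submodule.subtype_apply, map_add, LinearMap.add_apply]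
      ring
  · intro z
    have hsplit : (z : V) = ((z : V) - ℓ z • e) + ℓ z • e := by simp
    have h0 := hΩ _ (hZ z z.2)
    simp only [LinearMap.comp_apply, Submodule.subtype_apply, QuadraticMap.comp_apply,
      LinearMap.BilinMap.toQuadraticMap_apply, hψ, A, residualBilin_apply]
    generalize ℓ z = t at *
    generalize (z : V) - t • e = x at *
    rw [hsplit]
    simp only [map_add, map_smul, LinearMap.add_apply, LinearMap.smul_apply, smul_eq_mul, h0]
    ring

lemma Submodule.finrank_sup_span_singleton_of_notMem {K V : Type*} [Field K] [AddCommGroup V]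
    [Module K V] [FiniteDimensional K V] {Ω : Submodule K V} {e : V} (he : e ∉ Ω) :
    Module.finrank K ↥(Ω ⊔ Submodule.span K {e}) = Module.finrank K Ω + 1 := by
  have h := Submodule.finrank_sup_add_finrank_inf_eq Ω (Submodule.span K {e})
  have he0 : e ≠ 0 := fun h => he (h ▸ Ω.zero_mem)
  have hinf : Ω ⊓ Submodule.span K {e} = ⊥ :=
    ((Submodule.disjoint_span_singleton' he0).2 he).eq_bot
  rw [hinf, finrank_bot, finrank_span_singleton he0] at h
  simpa using h

lemma Submodule.exists_finrank_eq_mem_le {K V : Type*} [Field K] [AddCommGroup V] [Module K V]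
    [FiniteDimensional K V] {Ω : Submodule K V} {y : V} (hy : y ∈ Ω) (hy0 : y ≠ 0) {n : ℕ}
    (hn : n + 1 ≤ Module.finrank K Ω) :
    ∃ W ≤ Ω, Module.finrank K W = n + 1 ∧ y ∈ W := by
  induction n with
  | zero =>
    exact ⟨_, (Submodule.span_singleton_le_iff_mem _ _).2 hy, finrank_span_singleton hy0,
      Submodule.mem_span_singleton_self y⟩
  | succ n ih =>
    obtain ⟨W, hW, hfin, hyW⟩ := ih (by omega)
    obtain ⟨e, heΩ, heW⟩ : ∃ e ∈ Ω, e ∉ W := by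
      by_contra! h
      have := Submodule.finrank_mono (show Ω ≤ W from h)
      omega
    refine ⟨_, sup_le hW ((Submodule.span_singleton_le_iff_mem _ _).2 heΩ), ?_,
      Submodule.mem_sup_left hyW⟩
    rw [Submodule.finrank_sup_span_singleton_of_notMem heW, hfin]

theorem cubic_containing_P3_hyperplane_swept_by_planes
    (F : MvPolynomial (Fin 6) ℂ) (hF0 : F ≠ 0) (hF : F.IsHomogeneous 3)
    (Ω : Submodule ℂ (Fin 6 → ℂ)) (hΩ : Module.finrank ℂ Ω = 4)
    (hΩF : ∀ x ∈ Ω, eval x F = 0) :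
    ∃ Z : Submodule ℂ (Fin 6 → ℂ), Module.finrank ℂ Z = 5 ∧ Ω ≤ Z ∧
      ((∀ x ∈ Z, eval x F = 0) ∨
        ∃ (L : Z →ₗ[ℂ] ℂ) (Q : QuadraticForm ℂ Z),
          LinearMap.ker L = Ω.comap Z.subtype ∧
          (∃ w : Z, w ≠ 0 ∧ ∀ z : Z, QuadraticMap.polar (⇑Q) w z = 0) ∧
          (∀ z : Z, eval (z : Fin 6 → ℂ) F = L z * Q z)) ∧
      (∀ y ∈ Z, y ≠ 0 → eval y F = 0 →
        ∃ W : Submodule ℂ (Fin 6 → ℂ), Module.finrank ℂ W = 3 ∧ y ∈ W ∧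
          ∀ w ∈ W, eval w F = 0) := by
  obtain ⟨T, hT⟩ := hF.exists_trilinear
  have b := Module.finBasis ℂ Ω
  obtain ⟨u, hu⟩ : ∃ u, u ∉ Ω := by
    by_contra! h
    have : Ω = ⊤ := (Submodule.eq_top_iff').2 h
    rw [this, finrank_top] at hΩ
    simp at hΩ
  have hΩu := Submodule.finrank_sup_span_singleton_of_notMem hu
  obtain ⟨v, hv⟩ : ∃ v, v ∉ Ω ⊔ Submodule.span ℂ {u} := by
    by_contra! h
    have : Ω ⊔ Submodule.span ℂ {u} = ⊤ := (Submodule.eq_top_iff').2 h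
    rw [this, finrank_top, hΩ] at hΩu
    simp at hΩu
  obtain ⟨s, t, hst, hdet⟩ := exists_nontrivial_zero_of_homogeneous
    (fun e => (residualMatrix T (fun i => (b i : Fin 6 → ℂ)) e).det) (Nat.succ_ne_zero _)
    (det_residualMatrix_smul T _) (differentiable_det_residualMatrix T _) u v
  have he : s • u + t • v ∉ Ω := by
    intro he
    have hu' : u ∈ Ω ⊔ Submodule.span ℂ {u} :=
      Submodule.mem_sup_right (Submodule.mem_span_singleton_self u)
    have ht : t = 0 := by
      by_contra ht
      refine hv (((Submodule.smul_mem_iff _ ht)).1 ?_)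
      exact (Submodule.add_mem_iff_right _ (Submodule.smul_mem _ s hu')).1
        (Submodule.mem_sup_left he)
    have hs : s ≠ 0 := hst.resolve_right (not_not.2 ht)
    rw [ht, zero_smul, add_zero] at he
    exact hu ((Submodule.smul_mem_iff _ hs).1 he)
  obtain ⟨L, Q, hL, ⟨w, hw0, hw⟩, hLQ⟩ := exists_singular_residual_quadric T
    (fun x hx => by rw [hT, hΩF x hx]) b he hdet
  simp only [hT] at hLQ
  have hZ := Submodule.finrank_sup_span_singleton_of_notMem he
  rw [hΩ] at hZ
  refine ⟨_, hZ, le_sup_left, .inr ⟨L, Q, hL, ⟨w, hw0, hw⟩, hLQ⟩, fun y hy hy0 hyF => ?_⟩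
  rw [hLQ ⟨y, hy⟩, mul_eq_zero] at hyF
  rcases hyF with hLy | hQy
  · have hyΩ : y ∈ Ω := by
      have : (⟨y, hy⟩ : ↥(Ω ⊔ Submodule.span ℂ {s • u + t • v})) ∈ LinearMap.ker L := hLy
      rwa [hL] at this
    obtain ⟨W, hWΩ, hW, hyW⟩ := Submodule.exists_finrank_eq_mem_le (n := 2) hyΩ hy0 (by omega)
    exact ⟨W, hW, hyW, fun x hx => hΩF x (hWΩ hx)⟩
  · obtain ⟨W, hW, hyW, hQW⟩ := exists_totally_isotropic_of_singular hZ.ge Q hw0 hw hQy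
    refine ⟨W.map (Submodule.subtype _), ?_, ⟨_, hyW, rfl⟩, ?_⟩
    · rw [Submodule.finrank_map_subtype_eq, hW]
    · rintro _ ⟨x, hx, rfl⟩
      rw [Submodule.subtype_apply, hLQ x, hQW x hx, mul_zero]
end

section
/- Let F ∈ ℂ[X₀,…,X₅] be a nonzero homogeneous cubic and Y = V(F) ⊂ ℙ⁵ the corresponding cubic hypersurface. Suppose Y is a cone, i.e. there exists a point p ∈ Y such that for every y ∈ Y the projective line through p and y is contained in Y. Then Y contains a plane: there is a 3-dimensional linear subspace W ⊆ ℂ⁶ with F vanishing identically on W. -/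
/- STATEMENT 5: a cubic hypersurface in ℙ⁵ which is a cone contains a plane. -/

open MvPolynomial

section CommonZeros

variable {K : Type*} [Field K] {n : ℕ}

/-- The prime ideal generated by the first `k` variables, realized as the kernel of the map
killing these variables. -/
noncomputable def initialVariablesIdeal (K : Type*) [Field K] (n k : ℕ) :
    Ideal (MvPolynomial (Fin n) K) :=
  RingHom.ker (aeval (R := K) fun i : Fin n =>
    if (i : ℕ) < k then (0 : MvPolynomial (Fin n) K) else X i)

instance initialVariablesIdeal_isPrime (k : ℕ) : (initialVariablesIdeal K n k).IsPrime :=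
  RingHom.ker_isPrime _

theorem initialVariablesIdeal_lt_succ {k : ℕ} (hk : k < n) :
    initialVariablesIdeal K n k < initialVariablesIdeal K n (k + 1) := by
  refine lt_of_le_of_ne (fun f hf => ?_) fun h => ?_
  · have hcomp : (aeval (R := K) fun i : Fin n =>
        if (i : ℕ) < k + 1 then (0 : MvPolynomial (Fin n) K) else X i) =
        (aeval (R := K) fun i : Fin n =>
          if (i : ℕ) < k + 1 then (0 : MvPolynomial (Fin n) K) else X i).comp
        (aeval (R := K) fun i : Fin n =>
          if (i : ℕ) < k then (0 : MvPolynomial (Fin n) K) else X i) := by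
      refine algHom_ext fun i => ?_
      by_cases hi : (i : ℕ) < k
      · simp [hi, hi.le]
      · simp [hi]
    rw [initialVariablesIdeal, RingHom.mem_ker] at hf ⊢
    rw [hcomp, AlgHom.comp_apply, hf, map_zero]
  · have hmem : (X ⟨k, hk⟩ : MvPolynomial (Fin n) K) ∈ initialVariablesIdeal K n (k + 1) := by
      simp [initialVariablesIdeal, RingHom.mem_ker]
    rw [← h] at hmem
    simp [initialVariablesIdeal, RingHom.mem_ker] at hmem

theorem le_height_initialVariablesIdeal {k : ℕ} (hk : k ≤ n) :
    (k : ℕ∞) ≤ (initialVariablesIdeal K n k).height := by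
  induction k with
  | zero => simp
  | succ k ih =>
    have h := Ideal.height_add_one_le_of_lt_of_isPrime
      (initialVariablesIdeal_lt_succ (K := K) (Nat.lt_of_succ_le hk))
    push_cast
    exact (add_le_add_left (ih (Nat.le_of_succ_le hk)) 1).trans h

theorem mem_initialVariablesIdeal_self {f : MvPolynomial (Fin n) K} :
    f ∈ initialVariablesIdeal K n n ↔ eval 0 f = 0 := by
  have h : (fun i : Fin n => if (i : ℕ) < n then (0 : MvPolynomial (Fin n) K) else X i) = 0 := by
    ext1 i
    simp
  rw [initialVariablesIdeal, RingHom.mem_ker, h, aeval_zero, eval_zero]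
  simp

/-- Fewer than `n` polynomials in `n` variables over an algebraically closed field that vanish at
the origin have another common zero. -/
theorem exists_ne_zero_forall_eval_eq_zero [IsAlgClosed K]
    {S : Set (MvPolynomial (Fin n) K)} (hS : S.Finite) (hcard : S.ncard < n)
    (h0 : ∀ f ∈ S, eval 0 f = 0) :
    ∃ v : Fin n → K, v ≠ 0 ∧ ∀ f ∈ S, eval v f = 0 := by
  by_contra! hv
  have hmin : initialVariablesIdeal K n n ∈ (Ideal.span S).minimalPrimes := by
    refine ⟨⟨inferInstance, Ideal.span_le.2 fun f hf =>
      mem_initialVariablesIdeal_self.2 (h0 f hf)⟩, fun J hJ _ f hf => ?_⟩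
    refine hJ.1.radical_le_iff.2 hJ.2 ?_
    rw [← vanishingIdeal_zeroLocus_eq_radical (K := K), mem_vanishingIdeal_iff]
    intro x hx
    have hx0 : x = 0 := by
      by_contra hne
      obtain ⟨g, hg, hgx⟩ := hv x hne
      exact hgx (by simpa using hx g (Ideal.subset_span hg))
    rw [hx0]
    simpa using mem_initialVariablesIdeal_self.1 hf
  have h := (le_height_initialVariablesIdeal (K := K) le_rfl).trans
    (Ideal.height_le_card_of_mem_minimalPrimes_span hS hmin)
  exact absurd (by exact_mod_cast h) (not_le.2 hcard)

end CommonZeros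

section Lines

variable {K σ : Type*} [Field K] {F : MvPolynomial σ K} {d : ℕ}

theorem natDegree_aeval_le_totalDegree (F : MvPolynomial σ K) {g : σ → Polynomial K}
    (hg : ∀ i, (g i).natDegree ≤ 1) : (aeval g F).natDegree ≤ F.totalDegree := by
  rw [aeval_def, eval₂_eq]
  refine Polynomial.natDegree_sum_le_of_forall_le _ _ fun m hm => ?_
  refine (Polynomial.natDegree_C_mul_le _ _).trans ((Polynomial.natDegree_prod_le _ _).trans ?_)
  refine (Finset.sum_le_sum fun i _ => ?_).trans (le_totalDegree hm)
  exact Polynomial.natDegree_pow_le.trans (by simpa using Nat.mul_le_mul_left (m i) (hg i))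

theorem MvPolynomial.IsHomogeneous.eval_smul_eq (hF : F.IsHomogeneous d) (c : K) (x : σ → K) :
    eval (c • x) F = c ^ d * eval x F := by
  simp only [eval_eq, Finset.mul_sum]
  refine Finset.sum_congr rfl fun m hm => ?_
  have hm : ∑ i ∈ m.support, m i = d := by
    rw [← hF (mem_support_iff.1 hm), Pi.one_def, ← Finsupp.degree_eq_weight_one,
      Finsupp.degree_apply]
  simp only [Pi.smul_apply, smul_eq_mul, mul_pow, Finset.prod_mul_distrib,
    Finset.prod_pow_eq_pow_sum, hm]
  ring

theorem eval_aeval_line (F : MvPolynomial σ K) (x v : σ → K) (t : K) :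
    (aeval (fun i => Polynomial.C (x i) + Polynomial.C (v i) * Polynomial.X) F).eval t =
      eval (x + t • v) F := by
  induction F using MvPolynomial.induction_on with
  | C a => simp
  | add f g hf hg => simp only [map_add, Polynomial.eval_add, hf, hg]
  | mul_X f i hf => simp [hf, mul_comm (v i)]

/-- A form of degree `d` vanishing at more than `d` points of the line through `x` and `v`
vanishes on the whole line. -/
theorem MvPolynomial.IsHomogeneous.eval_line_eq_zero [Infinite K] (hF : F.IsHomogeneous d)
    {x v : σ → K} (T : Finset K) (hT : d < T.card) (h : ∀ t ∈ T, eval (x + t • v) F = 0)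
    (s t : K) : eval (s • x + t • v) F = 0 := by
  have hdeg : (MvPolynomial.aeval (fun i => Polynomial.C (x i) +
      Polynomial.C (v i) * Polynomial.X) F).natDegree ≤ d :=
    (natDegree_aeval_le_totalDegree F fun i => by compute_degree).trans hF.totalDegree_le
  have hx : ∀ t : K, eval (x + t • v) F = 0 := by
    have := Polynomial.eq_zero_of_natDegree_lt_card_of_eval_eq_zero' _ T
      (fun t ht => (eval_aeval_line F x v t).trans (h t ht)) (hdeg.trans_lt hT)
    intro t
    rw [← eval_aeval_line, this, Polynomial.eval_zero]
  have hne : ∀ s : K, s ≠ 0 → ∀ t : K, eval (s • x + t • v) F = 0 := by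
    intro s hs t
    have : s • x + t • v = s • (x + (s⁻¹ * t) • v) := by
      rw [smul_add, smul_smul, mul_inv_cancel_left₀ hs]
    rw [this, hF.eval_smul_eq, hx, mul_zero]
  have hzero : MvPolynomial.aeval (fun i => Polynomial.C ((t • v) i) +
      Polynomial.C (x i) * Polynomial.X) F = 0 := by
    refine Polynomial.eq_zero_of_infinite_isRoot _
      ((Set.finite_singleton (0 : K)).infinite_compl.mono fun s hs => ?_)
    change Polynomial.eval s _ = 0
    rw [eval_aeval_line, add_comm]
    exact hne s hs t
  rw [add_comm, ← eval_aeval_line, hzero, Polynomial.eval_zero]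

end Lines

/-- A cubic form in at least six variables over an algebraically closed field of characteristic
zero vanishes on a projective line avoiding a given point. -/
theorem MvPolynomial.IsHomogeneous.exists_line_of_cubic {K : Type*} [Field K] [IsAlgClosed K]
    [CharZero K] {n : ℕ} (hn : 6 ≤ n) {F : MvPolynomial (Fin n) K} (hF : F.IsHomogeneous 3)
    {p : Fin n → K} (hp : p ≠ 0) :
    ∃ y v : Fin n → K, LinearIndependent K ![p, y, v] ∧
      ∀ s t : K, eval (s • y + t • v) F = 0 := by
  classical
  have hF0 : eval 0 F = 0 := by
    simpa using hF.eval_smul_eq 0 0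
  obtain ⟨i, hi⟩ := Function.ne_iff.1 hp
  rw [Pi.zero_apply] at hi
  obtain ⟨y, hy, hyS⟩ := exists_ne_zero_forall_eval_eq_zero
    (S := (({X i, F} : Finset (MvPolynomial (Fin n) K)) :
      Set (MvPolynomial (Fin n) K))) (Finset.finite_toSet _)
    (by
      rw [Set.ncard_coe_finset]
      exact Finset.card_le_two.trans_lt (by omega))
    (by simp [-eval_zero, -eval_zero', hF0])
  simp only [Finset.coe_insert, Finset.coe_singleton, Set.mem_insert_iff, Set.mem_singleton_iff,
    forall_eq_or_imp, forall_eq, eval_X] at hyS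
  obtain ⟨hyi, hyF⟩ := hyS
  obtain ⟨j, hj⟩ := Function.ne_iff.1 hy
  rw [Pi.zero_apply] at hj
  let G (c : K) : MvPolynomial (Fin n) K := bind₁ (fun k => C (y k) + C c * X k) F
  have hG (c : K) (x : Fin n → K) : eval x (G c) = eval (y + c • x) F := by
    simp only [G, ← coe_aeval_eq_eval, RingHom.coe_coe, aeval_bind₁]
    congr 2
    ext k
    simp
  obtain ⟨v, hv, hvS⟩ := exists_ne_zero_forall_eval_eq_zero
    (S := (({X i, X j, G 1, G 2, G 3} : Finset (MvPolynomial (Fin n) K)) :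
      Set (MvPolynomial (Fin n) K)))
    (Finset.finite_toSet _)
    (by
      rw [Set.ncard_coe_finset]
      exact Finset.card_le_five.trans_lt (by omega))
    (by simp [-eval_zero, -eval_zero', hG, hyF])
  simp only [Finset.coe_insert, Finset.coe_singleton, Set.mem_insert_iff, Set.mem_singleton_iff,
    forall_eq_or_imp, forall_eq, eval_X, hG] at hvS
  obtain ⟨hvi, hvj, hv1, hv2, hv3⟩ := hvS
  refine ⟨y, v, ?_, hF.eval_line_eq_zero (Finset.image (Nat.cast : ℕ → K) (Finset.range 4)) ?_ ?_⟩
  · rw [Fintype.linearIndependent_iff]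
    intro g hg
    simp only [Fin.sum_univ_three, Matrix.cons_val] at hg
    have h0 : g 0 = 0 := by simpa [hyi, hvi, hi] using congrFun hg i
    have h1 : g 1 = 0 := by simpa [h0, hvj, hj] using congrFun hg j
    have h2 : g 2 = 0 := by simpa [h0, h1, hv] using hg
    intro k
    fin_cases k <;> assumption
  · rw [Finset.card_image_of_injective _ Nat.cast_injective, Finset.card_range]
    norm_num
  · simp only [Finset.mem_image, Finset.mem_range, forall_exists_index, and_imp,
      forall_apply_eq_imp_iff₂]
    intro m hm
    interval_cases m <;> simp_all

theorem cubic_cone_contains_plane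
    (F : MvPolynomial (Fin 6) ℂ) (hF0 : F ≠ 0) (hF : F.IsHomogeneous 3)
    (p : Fin 6 → ℂ) (hp : p ≠ 0) (hpY : eval p F = 0)
    (hcone : ∀ y : Fin 6 → ℂ, y ≠ 0 → eval y F = 0 →
      ∀ lam mu : ℂ, eval (lam • p + mu • y) F = 0) :
    ∃ W : Submodule ℂ (Fin 6 → ℂ), Module.finrank ℂ W = 3 ∧
      ∀ w ∈ W, eval w F = 0 := by
  obtain ⟨y, v, hli, hline⟩ := hF.exists_line_of_cubic le_rfl hp
  refine ⟨Submodule.span ℂ (Set.range ![p, y, v]), by simpa using finrank_span_eq_card hli,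
    fun w hw => ?_⟩
  obtain ⟨c, rfl⟩ := (Submodule.mem_span_range_iff_exists_fun ℂ).1 hw
  simp only [Fin.sum_univ_three, Matrix.cons_val, add_assoc]
  by_cases h : c 1 • y + c 2 • v = 0
  · rw [h, add_zero, hF.eval_smul_eq, hpY, mul_zero]
  · simpa using hcone _ h (hline (c 1) (c 2)) (c 0) 1
end

section
/- Let F ∈ ℂ[X₀,…,X₅] be a nonzero homogeneous cubic and let L ⊂ ℂ⁶ be a 2-dimensional linear subspace such that F and all its first partial derivatives vanish at every point of L (so the cubic hypersurface Y = V(F) ⊂ ℙ⁵ is singular along the line ℓ = ℙ(L)). Then there exists a 3-dimensional linear subspace W ⊂ ℂ⁶ with L ⊆ W and F vanishing identically on W; that is, Y contains a plane containing the line ℓ. -/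
/- STATEMENT 6: a cubic hypersurface in ℙ⁵ singular along a line ℓ contains a
plane containing ℓ. -/

open MvPolynomial

/-- Fewer than `n` polynomials in `n` variables over an algebraically closed field, all vanishing
at the origin, have a common zero other than the origin. -/
theorem exists_ne_zero_forall_eval_eq_zero_s6 {K σ ι : Type*} [Field K] [IsAlgClosed K] [Finite σ]
    [Finite ι] (hcard : Nat.card ι < Nat.card σ) (p : ι → MvPolynomial σ K)
    (hp : ∀ j, eval 0 (p j) = 0) :
    ∃ x : σ → K, x ≠ 0 ∧ ∀ j, eval x (p j) = 0 := by
  by_contra! hcon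
  have hdim : ringKrullDim (MvPolynomial σ K) ≤ (Nat.card ι : ℕ) := by
    refine (ringKrullDim_le_iff_isMaximal_height_le _).mpr fun M hM ↦ ?_
    obtain ⟨x, rfl⟩ := eq_vanishingIdeal_singleton_of_isMaximal K hM
    let q : ι → MvPolynomial σ K := fun j ↦ bind₁ (fun i ↦ X i - C (x i)) (p j)
    have hq (y : σ → K) (j : ι) : aeval y (q j) = eval (y - x) (p j) := by
      simp only [q, aeval_bind₁, map_sub, aeval_X, aeval_C, Algebra.algebraMap_self, RingHom.id_apply]
      rfl
    have hlocus : zeroLocus K (Ideal.span (Set.range q)) = {x} := by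
      rw [zeroLocus_span]
      ext y
      simp only [Set.forall_mem_range, Set.mem_ofPred_eq, Set.mem_singleton_iff, hq]
      constructor
      · intro h
        by_contra hne
        obtain ⟨j, hj⟩ := hcon (y - x) (sub_ne_zero.mpr hne)
        exact hj (h j)
      · rintro rfl
        simpa using hp
    have hrad : (Ideal.span (Set.range q)).radical = vanishingIdeal K {x} := by
      rw [← hlocus, vanishingIdeal_zeroLocus_eq_radical]
    have hmin : vanishingIdeal K {x} ∈ (Ideal.span (Set.range q)).minimalPrimes := by
      rw [← Ideal.radical_minimalPrimes, hrad, Ideal.minimalPrimes_eq_subsingleton_self]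
      rfl
    have hncard : (Set.range q).ncard ≤ Nat.card ι := by
      rw [← Set.image_univ, ← Set.ncard_univ]
      exact Set.ncard_image_le Set.finite_univ
    have hle : (vanishingIdeal K {x}).height ≤ (Nat.card ι : ℕ) :=
      (Ideal.height_le_card_of_mem_minimalPrimes_span (Set.finite_range q) hmin).trans
        (by exact_mod_cast hncard)
    exact_mod_cast hle
  rw [MvPolynomial.ringKrullDim_of_isNoetherianRing, ringKrullDim_eq_zero_of_field, zero_add] at hdim
  have : Nat.card σ ≤ Nat.card ι := by exact_mod_cast hdim
  omega

open scoped Pointwise in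
/-- The Taylor expansion of a cubic form along a line. -/
theorem MvPolynomial.IsHomogeneous.eval_add_smul_of_three {R σ : Type*} [CommRing R] [Fintype σ]
    {F : MvPolynomial σ R} (hF : F.IsHomogeneous 3) (x y : σ → R) (c : R) :
    eval (x + c • y) F = eval x F + c * ∑ i, y i * eval x (pderiv i F)
      + c ^ 2 * ∑ i, x i * eval y (pderiv i F) + c ^ 3 * eval y F := by
  classical
  have hmem : F ∈ Submodule.span R (Set.range (X : σ → MvPolynomial σ R)) ^ 3 := by
    rwa [← homogeneousSubmodule_one_eq_span_X, homogeneousSubmodule_one_pow]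
  rw [Submodule.span_pow] at hmem
  clear hF
  induction hmem using Submodule.span_induction with
  | mem F h =>
    simp only [pow_succ, pow_zero, one_mul, Set.mem_mul, Set.mem_range] at h
    obtain ⟨_, ⟨_, ⟨i, rfl⟩, _, ⟨j, rfl⟩, rfl⟩, _, ⟨k, rfl⟩, rfl⟩ := h
    simp only [Derivation.leibniz, pderiv_X, smul_eq_mul, map_add, map_mul, eval_X, Pi.single_apply,
      Pi.add_apply, Pi.smul_apply, mul_add, Finset.sum_add_distrib, apply_ite (eval _),
      map_zero, mul_ite, mul_one, mul_zero, Finset.sum_ite_eq, Finset.mem_univ, if_true]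
    ring
  | zero => simp
  | add F G _ _ hF hG =>
    simp only [map_add, mul_add, Finset.sum_add_distrib, hF, hG]
    ring
  | smul a F _ hF =>
    simp only [Derivation.map_smul, smul_eval, hF, mul_left_comm _ a, ← Finset.mul_sum]
    ring

theorem cubic_singular_along_line_contains_plane
    (F : MvPolynomial (Fin 6) ℂ) (hF0 : F ≠ 0) (hF : F.IsHomogeneous 3)
    (L : Submodule ℂ (Fin 6 → ℂ)) (hL : Module.finrank ℂ L = 2)
    (hsing : ∀ x ∈ L, eval x F = 0 ∧ ∀ i : Fin 6, eval x (pderiv i F) = 0) :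
    ∃ W : Submodule ℂ (Fin 6 → ℂ), Module.finrank ℂ W = 3 ∧ L ≤ W ∧
      ∀ w ∈ W, eval w F = 0 := by
  have e : L ≃ₗ[ℂ] (Fin 2 → ℂ) := LinearEquiv.ofFinrankEq _ _ (by simp [hL])
  obtain ⟨f, hf⟩ := LinearMap.exists_extend e.toLinearMap
  have hfe (x : L) : f x = e x := LinearMap.congr_fun hf x
  let a : Fin 2 → Fin 6 → ℂ := fun j ↦ e.symm (Pi.single j 1)
  let p : Fin 2 ⊕ Fin 2 ⊕ Unit → MvPolynomial (Fin 6) ℂ := Sum.elim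
    (fun j ↦ ∑ i, C (f (Pi.single i 1) j) * X i)
    (Sum.elim (fun j ↦ ∑ i, C (a j i) * pderiv i F) fun _ ↦ F)
  have hp1 (y : Fin 6 → ℂ) (j : Fin 2) : eval y (p (.inl j)) = f y j := by
    conv_rhs => rw [pi_eq_sum_univ' y]
    simp [p, mul_comm]
  have hp2 (y : Fin 6 → ℂ) (j : Fin 2) :
      eval y (p (.inr (.inl j))) = ∑ i, a j i * eval y (pderiv i F) := by
    simp [p]
  obtain ⟨y, hy0, hy⟩ := exists_ne_zero_forall_eval_eq_zero_s6 (by simp) p (by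
    obtain ⟨h0, h1⟩ := hsing 0 L.zero_mem
    rintro (j | j | j)
    · rw [hp1, map_zero, Pi.zero_apply]
    · simp only [hp2, h1, mul_zero, Finset.sum_const_zero]
    · exact h0)
  have hfy : f y = 0 := funext fun j ↦ by rw [← hp1, hy]; rfl
  have hFy : eval y F = 0 := hy (.inr (.inr ()))
  have hyL : y ∉ L := fun h ↦ hy0 <| by
    have : e ⟨y, h⟩ = 0 := by rw [← hfe, hfy]
    simpa using this
  have hD (x : Fin 6 → ℂ) (hx : x ∈ L) : ∑ i, x i * eval y (pderiv i F) = 0 := by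
    have hxa : x = ∑ j, e ⟨x, hx⟩ j • a j := by
      have h : (⟨x, hx⟩ : L) = ∑ j, e ⟨x, hx⟩ j • e.symm (Pi.single j 1) := by
        apply e.injective
        simpa using pi_eq_sum_univ' (e ⟨x, hx⟩)
      simpa [a] using congrArg Subtype.val h
    have ha (j : Fin 2) : ∑ i, a j i * eval y (pderiv i F) = 0 := by rw [← hp2, hy]
    rw [hxa]
    simp only [Finset.sum_apply, Pi.smul_apply, smul_eq_mul, Finset.sum_mul, mul_assoc]
    rw [Finset.sum_comm]
    simp [← Finset.mul_sum, ha]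
  refine ⟨L ⊔ Submodule.span ℂ {y}, ?_, le_sup_left, fun w hw ↦ ?_⟩
  · have h := Submodule.finrank_sup_add_finrank_inf_eq L (Submodule.span ℂ {y})
    have hd : L ⊓ Submodule.span ℂ {y} = ⊥ :=
      disjoint_iff.mp ((Submodule.disjoint_span_singleton' hy0).mpr hyL)
    rw [hd, finrank_bot, hL, finrank_span_singleton hy0] at h
    exact h
  · obtain ⟨x, hx, z, hz, rfl⟩ := Submodule.mem_sup.mp hw
    obtain ⟨c, rfl⟩ := Submodule.mem_span_singleton.mp hz
    rw [hF.eval_add_smul_of_three, hD x hx, hFy]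
    simp [hsing x hx]
end

section
/- Let F ∈ ℂ[X₀,…,X₅] be an irreducible homogeneous cubic such that the singular locus Sing V(F) = {[x] ∈ ℙ⁵ : ∂F/∂Xᵢ(x) = 0 for all i} of the cubic hypersurface Y = V(F) has dimension 3 (as a Zariski-closed subset of ℙ⁵). Then Sing V(F) has exactly one 3-dimensional irreducible component, and this component is a 3-dimensional projective linear space, i.e. the projectivization ℙ(V) of a 4-dimensional linear subspace V ⊂ ℂ⁶; in particular Y contains planes. -/
/- STATEMENT 7: an irreducible cubic hypersurface Y = V(F) ⊂ ℙ⁵ whose singular locus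
has dimension 3 has exactly one 3-dimensional irreducible component of the singular
locus, and it is a 3-dimensional projective linear space ℙ(V); in particular Y
contains planes. -/

open MvPolynomial

/-- The Zariski topology on ℙ⁵(ℂ) = ℙ(ℂ⁶): closed sets are common zero loci of
families of homogeneous polynomials. -/
noncomputable def zarTop : TopologicalSpace (Projectivization ℂ (Fin 6 → ℂ)) :=
  TopologicalSpace.generateFrom
    {U | ∃ f : MvPolynomial (Fin 6) ℂ, (∃ n : ℕ, f.IsHomogeneous n) ∧
          U = {x | eval x.rep f ≠ 0}}

/-- Topological Krull dimension of a subset of ℙ⁵(ℂ) for the Zariski topology: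
the supremum of lengths of chains of irreducible closed subsets. -/
noncomputable def projDim (S : Set (Projectivization ℂ (Fin 6 → ℂ))) : WithBot ℕ∞ :=
  @topologicalKrullDim S (TopologicalSpace.induced Subtype.val zarTop)

/-- The singular locus Sing V(F) = {[x] ∈ ℙ⁵ : ∂F/∂Xᵢ(x) = 0 for all i}. -/
def singLocus (F : MvPolynomial (Fin 6) ℂ) : Set (Projectivization ℂ (Fin 6 → ℂ)) :=
  {x | ∀ i : Fin 6, eval x.rep (pderiv i F) = 0}

/-- `T` is an irreducible component of `S`: a maximal irreducible subset of `S`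
(for the Zariski topology). -/
def IsIrredComponentOf (S T : Set (Projectivization ℂ (Fin 6 → ℂ))) : Prop :=
  T ⊆ S ∧ @IsIrreducible _ zarTop T ∧
    ∀ T' : Set (Projectivization ℂ (Fin 6 → ℂ)),
      T' ⊆ S → @IsIrreducible _ zarTop T' → T ⊆ T' → T' = T

section Vanishing

variable {σ K : Type*} [Field K]

theorem mem_vanishingIdeal_iff_eval {C : Set (σ → K)} {f : MvPolynomial σ K} :
    f ∈ vanishingIdeal K C ↔ ∀ x ∈ C, eval x f = 0 := by
  simp [mem_vanishingIdeal_iff, aeval_eq_eval]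

theorem isPrime_vanishingIdeal_iff {C : Set (σ → K)} :
    (vanishingIdeal K C).IsPrime ↔ C.Nonempty ∧ ∀ f g : MvPolynomial σ K,
      ∀ x ∈ C, ∀ y ∈ C, eval x f ≠ 0 → eval y g ≠ 0 → ∃ z ∈ C, eval z f ≠ 0 ∧ eval z g ≠ 0 := by
  rw [Ideal.isPrime_iff, Ideal.ne_top_iff_one]
  simp only [mem_vanishingIdeal_iff_eval, map_one, map_mul, mul_eq_zero, one_ne_zero, imp_false]
  refine and_congr ⟨fun h ↦ ?_, fun ⟨x, hx⟩ h ↦ h x hx⟩ ⟨fun h f g x hx y hy hf hg ↦ ?_, ?_⟩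
  · simpa [Set.Nonempty] using h
  · by_contra! H
    rcases h (x := f) (y := g) (fun z hz ↦ or_iff_not_imp_left.2 (H z hz)) with h | h
    exacts [hf (h x hx), hg (h y hy)]
  · intro h f g hfg
    by_contra! H
    obtain ⟨⟨x, hx, hf⟩, y, hy, hg⟩ := H
    obtain ⟨z, hz, hzf, hzg⟩ := h f g x hx y hy hf hg
    exact (hfg z hz).elim hzf hzg

/-- The restriction of a polynomial to the parametrized line `t ↦ x + t • p`. -/
noncomputable def restrictLine (x p : σ → K) : MvPolynomial σ K →ₐ[K] Polynomial K :=
  aeval fun i ↦ Polynomial.C (x i) + Polynomial.X * Polynomial.C (p i)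

theorem eval_restrictLine (x p : σ → K) (t : K) (f : MvPolynomial σ K) :
    (restrictLine x p f).eval t = eval (x + t • p) f := by
  have : (Polynomial.aeval t).comp (restrictLine x p) = aeval (R := K) (x + t • p) := by
    ext i
    simp [restrictLine, mul_comm (p i)]
  simpa [aeval_eq_eval, Polynomial.aeval_def, Polynomial.eval₂_eq_eval_map] using
    DFunLike.congr_fun this f

theorem exists_eval_add_smul_ne_zero [Infinite K] {f g : MvPolynomial σ K} {x y p q : σ → K}
    {s t : K} (hf : eval (x + s • p) f ≠ 0) (hg : eval (y + t • q) g ≠ 0) :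
    ∃ r : K, eval (x + r • p) f ≠ 0 ∧ eval (y + r • q) g ≠ 0 := by
  simp only [← eval_restrictLine] at *
  have hne : restrictLine x p f * restrictLine y q g ≠ 0 := by
    refine mul_ne_zero ?_ ?_ <;> rintro h <;> simp [h] at hf hg
  by_contra! H
  refine hne (Polynomial.funext fun r ↦ ?_)
  rw [Polynomial.eval_mul, Polynomial.eval_zero, mul_eq_zero]
  exact or_iff_not_imp_left.2 (H r)

/-- The image of a polynomial under the translation `x ↦ x + p`. -/
noncomputable def translatePoly (p : σ → K) : MvPolynomial σ K →ₐ[K] MvPolynomial σ K :=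
  aeval fun i ↦ X i + C (p i)

theorem eval_translatePoly (x p : σ → K) (f : MvPolynomial σ K) :
    eval x (translatePoly p f) = eval (x + p) f := by
  have : (aeval (R := K) x).comp (translatePoly p) = aeval (x + p) := by
    ext i
    simp [translatePoly]
  simpa [aeval_eq_eval] using DFunLike.congr_fun this f

/-- The union of all translates of `C` along the line spanned by `p`. -/
def cylinder (C : Set (σ → K)) (p : σ → K) : Set (σ → K) :=
  {y | ∃ x ∈ C, ∃ t : K, x + t • p = y}

theorem subset_cylinder (C : Set (σ → K)) (p : σ → K) : C ⊆ cylinder C p :=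
  fun x hx ↦ ⟨x, hx, 0, by simp⟩

theorem isPrime_vanishingIdeal_cylinder [Infinite K] {C : Set (σ → K)}
    (hC : (vanishingIdeal K C).IsPrime) (p : σ → K) :
    (vanishingIdeal K (cylinder C p)).IsPrime := by
  rw [isPrime_vanishingIdeal_iff] at hC ⊢
  refine ⟨hC.1.mono (subset_cylinder C p), ?_⟩
  rintro f g _ ⟨x, hx, s, rfl⟩ _ ⟨y, hy, t, rfl⟩ hf hg
  rw [← eval_translatePoly] at hf hg
  obtain ⟨z, hz, hzf, hzg⟩ := hC.2 _ _ x hx y hy hf hg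
  rw [eval_translatePoly] at hzf hzg
  obtain ⟨r, hr⟩ := exists_eval_add_smul_ne_zero hzf hzg
  exact ⟨_, ⟨z, hz, r, rfl⟩, hr⟩

theorem isPrime_vanishingIdeal_submodule [Infinite K] (V : Submodule K (σ → K)) :
    (vanishingIdeal K (V : Set (σ → K))).IsPrime := by
  refine isPrime_vanishingIdeal_iff.2 ⟨⟨0, V.zero_mem⟩, fun f g x hx y hy hf hg ↦ ?_⟩
  obtain ⟨r, hr⟩ := exists_eval_add_smul_ne_zero (x := x) (y := x) (p := y - x) (q := y - x)
    (s := 0) (t := 1) (f := f) (g := g) (by simpa using hf) (by simpa using hg)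
  exact ⟨_, V.add_mem hx (V.smul_mem r (V.sub_mem hy hx)), hr⟩

/-- The directions along which a set is invariant under all translations. -/
def translationStabilizer (A : Set (σ → K)) : Submodule K (σ → K) where
  carrier := {p | ∀ x ∈ A, ∀ t : K, x + t • p ∈ A}
  zero_mem' := by simp
  add_mem' := fun hp hq x hx t ↦ by
    simpa only [smul_add, add_assoc] using hq _ (hp x hx t) t
  smul_mem' := fun c p hp x hx t ↦ by
    simpa only [smul_smul] using hp x hx (t * c)

theorem translationStabilizer_subset {A : Set (σ → K)} (hA : 0 ∈ A) :
    (translationStabilizer A : Set (σ → K)) ⊆ A :=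
  fun p hp ↦ by simpa using hp 0 hA 1

theorem exists_notMem_of_finrank_lt [Fintype σ] {V : Submodule K (σ → K)}
    (hV : Module.finrank K V < Fintype.card σ) : ∃ v, v ∉ V := by
  by_contra! H
  rw [(eq_top_iff.2 fun x _ ↦ H x : V = ⊤), finrank_top, Module.finrank_fintype_fun_eq_card] at hV
  exact hV.false

theorem exists_lt_finrank_le_add_one [Fintype σ] {V : Submodule K (σ → K)}
    (hV : Module.finrank K V < Fintype.card σ) :
    ∃ W, V < W ∧ Module.finrank K W ≤ Module.finrank K V + 1 := by
  obtain ⟨v, hv⟩ := exists_notMem_of_finrank_lt hV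
  have hv0 : v ≠ 0 := by
    rintro rfl
    exact hv V.zero_mem
  refine ⟨V ⊔ Submodule.span K {v}, ?_, ?_⟩
  · exact left_lt_sup.2 fun h ↦ hv (h (Submodule.mem_span_singleton_self v))
  · exact (Submodule.finrank_add_le_finrank_add_finrank _ _).trans
      (Nat.add_le_add_left (finrank_span_singleton hv0).le _)

section LinearForm

variable [Fintype σ] [DecidableEq σ]

/-- The homogeneous polynomial of degree one defined by a linear form. -/
noncomputable def linearPoly (l : (σ → K) →ₗ[K] K) : MvPolynomial σ K :=
  ∑ i, C (l (Pi.single i 1)) * X i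

@[simp]
theorem eval_linearPoly (l : (σ → K) →ₗ[K] K) (x : σ → K) : eval x (linearPoly l) = l x := by
  conv_rhs => rw [pi_eq_sum_univ' x]
  simp [linearPoly, mul_comm]

theorem totalDegree_linearPoly_le (l : (σ → K) →ₗ[K] K) : (linearPoly l).totalDegree ≤ 1 :=
  totalDegree_finsetSum_le fun i _ ↦ (totalDegree_mul _ _).trans (by simp)

theorem linearPoly_ne_zero {l : (σ → K) →ₗ[K] K} (hl : l ≠ 0) : linearPoly l ≠ 0 := by
  rintro h
  exact hl (LinearMap.ext fun x ↦ by rw [← eval_linearPoly, h]; simp)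

theorem not_dvd_linearPoly {F : MvPolynomial σ K} (hF : 1 < F.totalDegree)
    {l : (σ → K) →ₗ[K] K} (hl : l ≠ 0) : ¬ F ∣ linearPoly l := by
  rintro ⟨G, hG⟩
  have hne := linearPoly_ne_zero hl
  have h := totalDegree_linearPoly_le l
  rw [hG] at hne h
  rw [totalDegree_mul_of_isDomain (left_ne_zero_of_mul hne) (right_ne_zero_of_mul hne)] at h
  lia

theorem linearPoly_dvd_of_forall_eval_eq_zero [Infinite K] {F : MvPolynomial σ K}
    {l : (σ → K) →ₗ[K] K} (hl : l ≠ 0) (h : ∀ x, l x = 0 → eval x F = 0) : linearPoly l ∣ F := by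
  obtain ⟨v, hv⟩ : ∃ v, l v ≠ 0 := by
    by_contra! H
    exact hl (LinearMap.ext H)
  obtain ⟨c, hc⟩ : ∃ c, l c = 1 := ⟨(l v)⁻¹ • v, by simp [hv]⟩
  let φ : MvPolynomial σ K →ₐ[K] MvPolynomial σ K := aeval fun i ↦ X i - C (c i) * linearPoly l
  have hφ (x : σ → K) (f : MvPolynomial σ K) : eval x (φ f) = eval (x - l x • c) f := by
    have : (aeval (R := K) x).comp φ = aeval (x - l x • c) := by
      ext i
      simp [φ, aeval_eq_eval, mul_comm]
    simpa [aeval_eq_eval] using DFunLike.congr_fun this f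
  have hφF : φ F = 0 := MvPolynomial.funext fun x ↦ by
    rw [hφ, map_zero]
    exact h _ (by simp [hc])
  have hmk : (Ideal.Quotient.mkₐ K (Ideal.span {linearPoly l})).comp φ =
      Ideal.Quotient.mkₐ K (Ideal.span {linearPoly l}) := by
    ext i
    simp [φ, Ideal.Quotient.eq_zero_iff_mem.2 (Ideal.mem_span_singleton_self (linearPoly l))]
  rw [← Ideal.mem_span_singleton, ← Ideal.Quotient.eq_zero_iff_mem]
  simpa [hφF] using (DFunLike.congr_fun hmk F).symm

theorem vanishingIdeal_submodule_lt [Infinite K] {V W : Submodule K (σ → K)} (h : V < W) :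
    vanishingIdeal K (W : Set (σ → K)) < vanishingIdeal K (V : Set (σ → K)) := by
  obtain ⟨hle, w, hw, hwV⟩ := SetLike.lt_iff_le_and_exists.1 h
  obtain ⟨l, hlw, hl⟩ := V.exists_le_ker_of_notMem hwV
  refine SetLike.lt_iff_le_and_exists.2 ⟨vanishingIdeal_anti_mono hle, linearPoly l, ?_, ?_⟩
  · exact mem_vanishingIdeal_iff_eval.2 fun x hx ↦ by simpa using hl hx
  · exact fun H ↦ hlw (by simpa using mem_vanishingIdeal_iff_eval.1 H w hw)

theorem subset_or_subset_of_subset_union {C : Set (σ → K)} (hC : (vanishingIdeal K C).IsPrime)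
    {V W : Submodule K (σ → K)} (h : C ⊆ V ∪ W) : C ⊆ V ∨ C ⊆ W := by
  by_contra! H
  simp only [Set.not_subset] at H
  obtain ⟨⟨x, hx, hxV⟩, y, hy, hyW⟩ := H
  obtain ⟨l, hlx, hl⟩ := V.exists_le_ker_of_notMem hxV
  obtain ⟨m, hmy, hm⟩ := W.exists_le_ker_of_notMem hyW
  obtain ⟨z, hz, hlz, hmz⟩ := (isPrime_vanishingIdeal_iff.1 hC).2 (linearPoly l) (linearPoly m)
    x hx y hy (by simpa using hlx) (by simpa using hmy)
  rw [eval_linearPoly] at hlz hmz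
  exact (h hz).elim (fun h ↦ hlz (hl h)) (fun h ↦ hmz (hm h))

/-- A linear subspace on which an irreducible polynomial of degree at least two vanishes has
codimension at least two. -/
theorem finrank_add_two_le_of_vanishing [Infinite K] {F : MvPolynomial σ K} (hF : Irreducible F)
    (hdeg : 1 < F.totalDegree) {V : Submodule K (σ → K)} (hV : ∀ x ∈ V, eval x F = 0) :
    Module.finrank K V + 2 ≤ Fintype.card σ := by
  by_contra! H
  have hVtop : V ≠ ⊤ := by
    rintro rfl
    exact hF.ne_zero (MvPolynomial.funext fun x ↦ by simpa using hV x trivial)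
  obtain ⟨v, hv⟩ : ∃ v, v ∉ V := by
    by_contra! H
    exact hVtop (eq_top_iff.2 fun x _ ↦ H x)
  obtain ⟨l, hlv, hl⟩ := V.exists_le_ker_of_notMem hv
  have hl0 : l ≠ 0 := by
    rintro rfl
    exact hlv rfl
  have hker : V = LinearMap.ker l := by
    refine Submodule.eq_of_le_of_finrank_le hl ?_
    have h1 := Module.Dual.finrank_ker_add_one_of_ne_zero hl0
    rw [Module.finrank_fintype_fun_eq_card] at h1
    lia
  obtain ⟨G, hG⟩ := linearPoly_dvd_of_forall_eval_eq_zero hl0 fun x hx ↦ hV x (by rwa [hker])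
  rcases hF.isUnit_or_isUnit hG with hu | hu
  · have := hu.map (eval (0 : σ → K))
    simp only [eval_linearPoly, map_zero, isUnit_zero_iff, zero_ne_one] at this
  · exact not_dvd_linearPoly hdeg hl0
      ((associated_mul_unit_right (linearPoly l) G hu).trans (.of_eq hG.symm)).symm.dvd

/-- A Zariski-closed irreducible set of codimension at most two whose points are pairwise joined by
lines inside an irreducible hypersurface of degree at least two is a linear subspace of
codimension two. -/
theorem eq_submodule_of_secant_vanishing [Infinite K] {F : MvPolynomial σ K} (hF : Irreducible F)
    (hdeg : 1 < F.totalDegree) {C : Set (σ → K)} (hC : (vanishingIdeal K C).IsPrime)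
    (hclosed : zeroLocus K (vanishingIdeal K C) ⊆ C) (hzero : 0 ∈ C)
    (hsec : ∀ x ∈ C, ∀ p ∈ C, ∀ t : K, eval (x + t • p) F = 0)
    (hcodim : ∀ P Q R : Ideal (MvPolynomial σ K), P.IsPrime → Q.IsPrime → R.IsPrime →
      P < Q → Q < R → ¬ R < vanishingIdeal K C) :
    ∃ V : Submodule K (σ → K), Module.finrank K V + 2 = Fintype.card σ ∧ C = V := by
  have hFprime : (Ideal.span {F}).IsPrime :=
    (Ideal.span_singleton_prime hF.ne_zero).2 hF.prime
  have hFpos : ⊥ < Ideal.span {F} := by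
    simpa [bot_lt_iff_ne_bot] using hF.ne_zero
  have hspan (D : Set (σ → K)) (hD : ∀ x ∈ D, eval x F = 0) :
      Ideal.span {F} ≤ vanishingIdeal K D := by
    rw [Ideal.span_singleton_le_iff_mem]
    exact mem_vanishingIdeal_iff_eval.2 hD
  have heq (D : Set (σ → K)) (hCD : C ⊆ D)
      (h : vanishingIdeal K D = vanishingIdeal K C) : C = D := by
    refine hCD.antisymm ((zeroLocus_vanishingIdeal_le (k := K) D).trans ?_)
    rwa [h]
  -- it suffices to enclose `C` in a linear subspace of the hypersurface
  have key (V : Submodule K (σ → K)) (hCV : C ⊆ V) (hV : ∀ x ∈ V, eval x F = 0) :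
      ∃ V : Submodule K (σ → K), Module.finrank K V + 2 = Fintype.card σ ∧ C = V := by
    have hfin := finrank_add_two_le_of_vanishing hF hdeg hV
    have hVprime := isPrime_vanishingIdeal_submodule V
    have hlt : Ideal.span {F} < vanishingIdeal K (V : Set (σ → K)) := by
      refine lt_of_le_of_ne (hspan _ hV) fun h ↦ ?_
      obtain ⟨v, hv⟩ := exists_notMem_of_finrank_lt (V := V) (by lia)
      obtain ⟨l, hlv, hl⟩ := V.exists_le_ker_of_notMem hv
      refine not_dvd_linearPoly hdeg (l := l) (by rintro rfl; exact hlv rfl) ?_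
      rw [← Ideal.mem_span_singleton, h, mem_vanishingIdeal_iff_eval]
      exact fun x hx ↦ by simpa using hl hx
    have hCV' : C = V := by
      refine heq _ hCV (eq_of_le_of_not_lt (vanishingIdeal_anti_mono hCV) ?_)
      exact hcodim _ _ _ Ideal.isPrime_bot hFprime hVprime hFpos hlt
    refine ⟨V, ?_, hCV'⟩
    by_contra hne
    obtain ⟨W₁, hW₁, hf₁⟩ := exists_lt_finrank_le_add_one (V := V) (by lia)
    obtain ⟨W₂, hW₂, hf₂⟩ := exists_lt_finrank_le_add_one (V := W₁) (by lia)
    obtain ⟨W₃, hW₃, -⟩ := exists_lt_finrank_le_add_one (V := W₂) (by lia)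
    refine hcodim _ _ _ (isPrime_vanishingIdeal_submodule W₃)
      (isPrime_vanishingIdeal_submodule W₂) (isPrime_vanishingIdeal_submodule W₁)
      (vanishingIdeal_submodule_lt hW₃) (vanishingIdeal_submodule_lt hW₂) ?_
    rw [hCV']
    exact vanishingIdeal_submodule_lt hW₁
  have hFzero : eval 0 F = 0 := by simpa using hsec 0 hzero 0 hzero 0
  have hunion : C ⊆ (translationStabilizer C : Set (σ → K)) ∪
      translationStabilizer {x | eval x F = 0} := by
    intro p hp
    have hcyl : ∀ y ∈ cylinder C p, eval y F = 0 := by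
      rintro _ ⟨x, hx, t, rfl⟩
      exact hsec x hx p hp t
    by_cases h : vanishingIdeal K (cylinder C p) = vanishingIdeal K C
    · left
      intro x hx t
      rw [heq _ (subset_cylinder C p) h]
      exact ⟨x, hx, t, rfl⟩
    · right
      have hspan_eq : Ideal.span {F} = vanishingIdeal K (cylinder C p) :=
        eq_of_le_of_not_lt (hspan _ hcyl) fun hlt ↦
          hcodim _ _ _ Ideal.isPrime_bot hFprime (isPrime_vanishingIdeal_cylinder hC p) hFpos hlt
            (lt_of_le_of_ne (vanishingIdeal_anti_mono (subset_cylinder C p)) h)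
      intro x hx t
      obtain ⟨G, hG⟩ : F ∣ translatePoly (t • p) F := by
        rw [← Ideal.mem_span_singleton, hspan_eq, mem_vanishingIdeal_iff_eval]
        rintro _ ⟨y, hy, s, rfl⟩
        rw [eval_translatePoly, add_assoc, ← add_smul]
        exact hsec y hy p hp _
      rw [Set.mem_ofPred_eq] at hx ⊢
      rw [← eval_translatePoly, hG, map_mul, hx, zero_mul]
  rcases subset_or_subset_of_subset_union hC hunion with h | h
  · refine key _ h fun x hx ↦ ?_
    simpa using hsec x (translationStabilizer_subset hzero hx) 0 hzero 0
  · exact key _ h fun x hx ↦ translationStabilizer_subset hFzero hx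

end LinearForm

end Vanishing

section Secant

theorem eval_eq_eval_of_isHomogeneous_zero {σ K : Type*} [Field K]
    {f : MvPolynomial σ K} (hf : f.IsHomogeneous 0)
    (x y : σ → K) : eval x f = eval y f := by
  rw [totalDegree_eq_zero_iff_eq_C.1 ((totalDegree_zero_iff_isHomogeneous σ).2 hf)]
  simp

variable {σ K : Type*} [Fintype σ] [Field K]

/-- The derivative of polynomials in the direction `u`. -/
noncomputable def dirDeriv (u : σ → K) : Derivation K (MvPolynomial σ K) (MvPolynomial σ K) :=
  ∑ i, u i • pderiv i

theorem dirDeriv_apply (u : σ → K) (f : MvPolynomial σ K) :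
    dirDeriv u f = ∑ i, u i • pderiv i f := by
  rw [dirDeriv, ← Derivation.coeFnAddMonoidHom_apply, map_sum, Finset.sum_apply]
  rfl

theorem dirDeriv_add (u v : σ → K) : dirDeriv (u + v) = dirDeriv u + dirDeriv v := by
  simp [dirDeriv, add_smul, Finset.sum_add_distrib]

theorem dirDeriv_X (u : σ → K) (i : σ) : dirDeriv u (X i) = C (u i) := by
  classical
  simp [dirDeriv_apply, pderiv_X, Pi.single_apply, smul_eq_C_mul]

theorem dirDeriv_comm (u v : σ → K) (f : MvPolynomial σ K) :
    dirDeriv u (dirDeriv v f) = dirDeriv v (dirDeriv u f) := by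
  have : ⁅dirDeriv u, dirDeriv v⁆ = 0 := derivation_ext fun i ↦ by
    simp [Derivation.commutator_apply, dirDeriv_X, ← algebraMap_eq]
  simpa [Derivation.commutator_apply, sub_eq_zero] using DFunLike.congr_fun this f

theorem isHomogeneous_dirDeriv {f : MvPolynomial σ K} {n : ℕ} (hf : f.IsHomogeneous n)
    (u : σ → K) : (dirDeriv u f).IsHomogeneous (n - 1) := by
  rw [dirDeriv_apply]
  refine IsHomogeneous.sum _ _ _ fun i _ ↦ ?_
  rw [smul_eq_C_mul]
  simpa using (isHomogeneous_C σ (u i)).mul hf.pderiv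

theorem eval_dirDeriv_self {f : MvPolynomial σ K} {n : ℕ} (hf : f.IsHomogeneous n)
    (x : σ → K) : eval x (dirDeriv x f) = n * eval x f := by
  simpa [dirDeriv_apply, smul_eval] using congrArg (eval x) hf.sum_X_mul_pderiv

/-- A cubic form vanishes on the line joining two of its singular points. -/
theorem eval_add_eq_zero_of_singular [CharZero K] {F : MvPolynomial σ K} (hF : F.IsHomogeneous 3)
    {p q : σ → K} (hp : ∀ i, eval p (pderiv i F) = 0) (hq : ∀ i, eval q (pderiv i F) = 0) :
    eval (p + q) F = 0 := by
  have hom₂ (u : σ → K) := isHomogeneous_dirDeriv hF u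
  have hom₁ (u v : σ → K) := isHomogeneous_dirDeriv (hom₂ u) v
  have hom₀ (u v w : σ → K) := isHomogeneous_dirDeriv (hom₁ u v) w
  have hsing {x : σ → K} (hx : ∀ i, eval x (pderiv i F) = 0) (u y : σ → K) :
      eval y (dirDeriv x (dirDeriv x (dirDeriv u F))) = 0 := by
    rw [eval_eq_eval_of_isHomogeneous_zero (hom₀ u x x) y x, eval_dirDeriv_self (hom₁ u x),
      eval_dirDeriv_self (hom₂ u), dirDeriv_apply]
    simp [smul_eval, hx]
  have hsing' {x : σ → K} (hx : ∀ i, eval x (pderiv i F) = 0) (u y : σ → K) :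
      eval y (dirDeriv x (dirDeriv u (dirDeriv x F))) = 0 := by
    rw [dirDeriv_comm u x, hsing hx]
  have hsing'' {x : σ → K} (hx : ∀ i, eval x (pderiv i F) = 0) (u y : σ → K) :
      eval y (dirDeriv u (dirDeriv x (dirDeriv x F))) = 0 := by
    rw [dirDeriv_comm u x, hsing' hx]
  have heuler : 6 * eval (p + q) F =
      eval (p + q) (dirDeriv (p + q) (dirDeriv (p + q) (dirDeriv (p + q) F))) := by
    rw [eval_dirDeriv_self (hom₁ _ _), eval_dirDeriv_self (hom₂ _), eval_dirDeriv_self hF]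
    push_cast
    ring
  have h6 : 6 * eval (p + q) F = 0 := by
    rw [heuler, dirDeriv_add]
    simp [hsing hp, hsing hq, hsing' hp, hsing' hq, hsing'' hp, hsing'' hq]
  simpa using h6

end Secant

theorem length_primeSpectrum_mvPolynomial_le {σ K : Type*} [Finite σ] [Field K]
    (l : LTSeries (PrimeSpectrum (MvPolynomial σ K))) : l.length ≤ Nat.card σ := by
  have h := Order.LTSeries.length_le_krullDim l
  rw [← ringKrullDim, MvPolynomial.ringKrullDim_of_isNoetherianRing, ringKrullDim_eq_zero_of_field,
    zero_add] at h
  exact_mod_cast h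
section Topology

variable {X Y : Type*} [TopologicalSpace X] [TopologicalSpace Y]

theorem Topology.IsInducing.isPreirreducible_of_image {f : Y → X} (hf : Topology.IsInducing f)
    {A : Set Y} (hA : IsPreirreducible (f '' A)) : IsPreirreducible A := by
  rintro u v hu hv ⟨x, hxA, hxu⟩ ⟨y, hyA, hyv⟩
  obtain ⟨U, hU, rfl⟩ := hf.isOpen_iff.1 hu
  obtain ⟨V, hV, rfl⟩ := hf.isOpen_iff.1 hv
  obtain ⟨_, ⟨z, hz, rfl⟩, hzU, hzV⟩ :=
    hA U V hU hV ⟨f x, ⟨x, hxA, rfl⟩, hxu⟩ ⟨f y, ⟨y, hyA, rfl⟩, hyv⟩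
  exact ⟨z, hz, hzU, hzV⟩

/-- A subspace of dimension at least `n` has an irreducible component of dimension at least `n`. -/
theorem exists_maximal_isIrreducible_of_le_topologicalKrullDim {S : Set X} {n : ℕ}
    (h : n ≤ topologicalKrullDim S) :
    ∃ T ⊆ S, IsIrreducible T ∧ (∀ T' ⊆ S, IsIrreducible T' → T ⊆ T' → T' = T) ∧
      n ≤ topologicalKrullDim T := by
  obtain ⟨l, rfl⟩ := Order.le_krullDim_iff.1 h
  obtain ⟨t, ht, hlt, hmax⟩ := exists_preirreducible _ l.last.isIrreducible.isPreirreducible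
  have hTS : Subtype.val '' t ⊆ S := Subtype.coe_image_subset S t
  have hsub (i : Fin (l.length + 1)) :
      Subtype.val '' (l i : Set S) ⊆ Subtype.val '' t :=
    Set.image_mono (subset_trans (SetLike.coe_subset_coe.2
      (LTSeries.monotone l (Fin.le_last i))) hlt)
  refine ⟨Subtype.val '' t, hTS, ⟨(l.last.isIrreducible.nonempty.mono hlt).image _,
    ht.image _ continuous_subtype_val.continuousOn⟩, fun T' hT' hirr hle ↦ ?_, ?_⟩
  · have himage : Subtype.val '' (Subtype.val ⁻¹' T' : Set S) = T' := by
      simpa using hT'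
    rw [← hmax (Subtype.val ⁻¹' T')
      (Topology.IsInducing.subtypeVal.isPreirreducible_of_image
        (by rw [himage]; exact hirr.isPreirreducible)) (Set.image_subset_iff.1 hle), himage]
  · let j : (Subtype.val '' t : Set X) → S := Set.inclusion hTS
    have hj : Topology.IsInducing j := (Topology.IsEmbedding.inclusion hTS).isInducing
    have himage (i : Fin (l.length + 1)) : j '' (j ⁻¹' (l i : Set S)) = l i := by
      rw [Set.image_preimage_eq_iff]
      intro x hx
      exact ⟨⟨x, hsub i ⟨x, hx, rfl⟩⟩, rfl⟩
    refine Order.le_krullDim_iff.2 ⟨LTSeries.mk l.length (fun i ↦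
      { carrier := j ⁻¹' (l i : Set S)
        isIrreducible' := ⟨?_, hj.isPreirreducible_of_image ?_⟩
        isClosed' := (l i).isClosed.preimage hj.continuous }) ?_, rfl⟩
    · have := (l i).isIrreducible.nonempty
      rw [← himage i] at this
      exact this.of_image
    · rw [himage i]
      exact (l i).isIrreducible.isPreirreducible
    · intro a b hab
      obtain ⟨hle, x, hxb, hxa⟩ := SetLike.lt_iff_le_and_exists.1 (LTSeries.strictMono l hab)
      exact SetLike.lt_iff_le_and_exists.2
        ⟨fun y hy ↦ hle hy, ⟨x, hsub b ⟨x, hxb, rfl⟩⟩, hxb, hxa⟩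

end Topology

section Cone

theorem MvPolynomial.IsHomogeneous.eval_smul {σ R : Type*} [CommSemiring R]
    {f : MvPolynomial σ R} {n : ℕ} (hf : f.IsHomogeneous n) (a : R) (x : σ → R) :
    eval (a • x) f = a ^ n * eval x f := by
  simp only [eval_eq, Finset.mul_sum]
  refine Finset.sum_congr rfl fun d hd ↦ ?_
  have hdeg : ∑ i ∈ d.support, d i = n := by
    rw [← Finsupp.degree_apply, Finsupp.degree_eq_weight_one]
    exact hf (mem_support_iff.1 hd)
  simp only [Pi.smul_apply, smul_eq_mul, mul_pow, Finset.prod_mul_distrib,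
    Finset.prod_pow_eq_pow_sum, hdeg]
  ring

theorem eval_homogeneousComponent_eq_zero {σ K : Type*} [Field K] [Infinite K]
    {f : MvPolynomial σ K} {x : σ → K} (h : ∀ t : K, eval (t • x) f = 0) (i : ℕ) :
    eval x (homogeneousComponent i f) = 0 := by
  have hzero : ∑ j ∈ Finset.range (f.totalDegree + 1),
      Polynomial.monomial j (eval x (homogeneousComponent j f)) = 0 := by
    refine Polynomial.funext fun t ↦ ?_
    rw [Polynomial.eval_zero, ← h t]
    conv_rhs => rw [← sum_homogeneousComponent f]
    simp [Polynomial.eval_finsetSum, (homogeneousComponent_isHomogeneous _ f).eval_smul, mul_comm]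
  by_cases hi : i < f.totalDegree + 1
  · simpa [Polynomial.finsetSum_coeff, Polynomial.coeff_monomial, hi] using
      congrArg (Polynomial.coeff · i) hzero
  · rw [homogeneousComponent_eq_zero _ _ (by lia), map_zero]

attribute [local instance] zarTop

/-- The affine cone over a set of points of projective space. -/
def affineCone (T : Set (Projectivization ℂ (Fin 6 → ℂ))) : Set (Fin 6 → ℂ) :=
  {v | ∃ x ∈ T, ∃ t : ℂ, t • x.rep = v}

variable {T : Set (Projectivization ℂ (Fin 6 → ℂ))}

theorem zero_mem_affineCone (hT : T.Nonempty) : 0 ∈ affineCone T :=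
  hT.imp fun _ hx ↦ ⟨hx, 0, zero_smul _ _⟩

theorem affineCone_mono {A B : Set (Projectivization ℂ (Fin 6 → ℂ))} (h : A ⊆ B) :
    affineCone A ⊆ affineCone B :=
  fun _ ⟨x, hx, t, ht⟩ ↦ ⟨x, h hx, t, ht⟩

theorem rep_mem_affineCone_iff {x : Projectivization ℂ (Fin 6 → ℂ)} :
    x.rep ∈ affineCone T ↔ x ∈ T := by
  refine ⟨fun ⟨y, hy, t, ht⟩ ↦ ?_, fun hx ↦ ⟨x, hx, 1, one_smul _ _⟩⟩
  have hxy := (Projectivization.mk_eq_mk_iff' ℂ _ _ x.rep_nonzero y.rep_nonzero).2 ⟨t, ht⟩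
  rw [Projectivization.mk_rep, Projectivization.mk_rep] at hxy
  rwa [hxy]

theorem mem_vanishingIdeal_affineCone {f : MvPolynomial (Fin 6) ℂ} {n : ℕ}
    (hf : f.IsHomogeneous n) (h : ∀ x ∈ T, eval x.rep f = 0) :
    f ∈ vanishingIdeal ℂ (affineCone T) := by
  rw [mem_vanishingIdeal_iff_eval]
  rintro _ ⟨x, hx, t, rfl⟩
  rw [hf.eval_smul, h x hx, mul_zero]

theorem isOpen_eval_rep_ne_zero {f : MvPolynomial (Fin 6) ℂ} {n : ℕ} (hf : f.IsHomogeneous n) :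
    IsOpen {x : Projectivization ℂ (Fin 6 → ℂ) | eval x.rep f ≠ 0} :=
  .basic _ ⟨f, ⟨n, hf⟩, rfl⟩

theorem exists_isHomogeneous_of_mem_isOpen {U : Set (Projectivization ℂ (Fin 6 → ℂ))}
    (hU : IsOpen U) {x : Projectivization ℂ (Fin 6 → ℂ)} (hx : x ∈ U) :
    ∃ (f : MvPolynomial (Fin 6) ℂ) (n : ℕ), f.IsHomogeneous n ∧ eval x.rep f ≠ 0 ∧
      ∀ y ∉ U, eval y.rep f = 0 := by
  induction hU with
  | basic _ h =>
    obtain ⟨f, ⟨n, hf⟩, rfl⟩ := h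
    exact ⟨f, n, hf, hx, fun y hy ↦ not_not.1 hy⟩
  | univ => exact ⟨1, 0, isHomogeneous_one _ _, by simp, fun y hy ↦ (hy trivial).elim⟩
  | inter U V _ _ hU hV =>
    obtain ⟨f, m, hf, hfx, hfU⟩ := hU hx.1
    obtain ⟨g, n, hg, hgx, hgV⟩ := hV hx.2
    refine ⟨f * g, m + n, hf.mul hg, by simp [hfx, hgx], fun y hy ↦ ?_⟩
    rw [map_mul, mul_eq_zero]
    exact (not_and_or.1 hy).imp (hfU y) (hgV y)
  | sUnion S _ ih =>
    obtain ⟨U, hUS, hxU⟩ := hx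
    obtain ⟨f, n, hf, hfx, hfU⟩ := ih U hUS hxU
    exact ⟨f, n, hf, hfx, fun y hy ↦ hfU y fun h ↦ hy ⟨U, hUS, h⟩⟩

theorem isPrime_vanishingIdeal_affineCone (hT : IsIrreducible T) :
    (vanishingIdeal ℂ (affineCone T)).IsPrime := by
  have hcomp {f : MvPolynomial (Fin 6) ℂ} {v : Fin 6 → ℂ} (hv : v ∈ affineCone T)
      (hf : eval v f ≠ 0) : ∃ x ∈ T, ∃ i, eval x.rep (homogeneousComponent i f) ≠ 0 := by
    obtain ⟨x, hx, t, rfl⟩ := hv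
    refine ⟨x, hx, ?_⟩
    by_contra! H
    refine hf ?_
    rw [← sum_homogeneousComponent f, map_sum]
    refine Finset.sum_eq_zero fun i _ ↦ ?_
    rw [(homogeneousComponent_isHomogeneous i f).eval_smul, H, mul_zero]
  refine isPrime_vanishingIdeal_iff.2 ⟨⟨0, zero_mem_affineCone hT.nonempty⟩,
    fun f g v hv w hw hf hg ↦ ?_⟩
  obtain ⟨x, hx, i, hi⟩ := hcomp hv hf
  obtain ⟨y, hy, j, hj⟩ := hcomp hw hg
  obtain ⟨z, hz, hzi, hzj⟩ := hT.isPreirreducible _ _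
    (isOpen_eval_rep_ne_zero (homogeneousComponent_isHomogeneous i f))
    (isOpen_eval_rep_ne_zero (homogeneousComponent_isHomogeneous j g)) ⟨x, hx, hi⟩ ⟨y, hy, hj⟩
  have hne {h : MvPolynomial (Fin 6) ℂ} {k : ℕ}
      (hk : eval z.rep (homogeneousComponent k h) ≠ 0) : ∃ t : ℂ, eval (0 + t • z.rep) h ≠ 0 := by
    by_contra! H
    exact hk (eval_homogeneousComponent_eq_zero (by simpa using H) k)
  obtain ⟨s, hs⟩ := hne hzi
  obtain ⟨t, ht⟩ := hne hzj
  obtain ⟨r, hr⟩ := exists_eval_add_smul_ne_zero hs ht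
  exact ⟨_, ⟨z, hz, r, (zero_add _).symm⟩, hr⟩

theorem vanishingIdeal_affineCone_lt {A B Z : Set (Projectivization ℂ (Fin 6 → ℂ))}
    (hAB : A ⊆ B) (hZ : IsClosed Z) (hAZ : A ⊆ Z) {x : Projectivization ℂ (Fin 6 → ℂ)}
    (hxB : x ∈ B) (hxZ : x ∉ Z) :
    vanishingIdeal ℂ (affineCone B) < vanishingIdeal ℂ (affineCone A) := by
  obtain ⟨f, n, hf, hfx, hfZ⟩ := exists_isHomogeneous_of_mem_isOpen hZ.isOpen_compl hxZ
  refine SetLike.lt_iff_le_and_exists.2 ⟨vanishingIdeal_anti_mono (affineCone_mono hAB), f,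
    mem_vanishingIdeal_affineCone hf fun y hy ↦ hfZ y (not_not.2 (hAZ hy)), fun h ↦ hfx ?_⟩
  exact mem_vanishingIdeal_iff_eval.1 h _ (rep_mem_affineCone_iff.2 hxB)

theorem vanishingIdeal_affineCone_lt_vanishingIdeal_bot (hT : T.Nonempty) :
    vanishingIdeal ℂ (affineCone T) <
      vanishingIdeal ℂ ((⊥ : Submodule ℂ (Fin 6 → ℂ)) : Set (Fin 6 → ℂ)) := by
  obtain ⟨x, hx⟩ := hT
  obtain ⟨l, hlx, -⟩ := (⊥ : Submodule ℂ (Fin 6 → ℂ)).exists_le_ker_of_notMem (v := x.rep)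
    (by simpa using x.rep_nonzero)
  refine SetLike.lt_iff_le_and_exists.2 ⟨vanishingIdeal_anti_mono ?_, linearPoly l, ?_, ?_⟩
  · simpa using zero_mem_affineCone ⟨x, hx⟩
  · simp
  · exact fun h ↦ hlx (by
      simpa using mem_vanishingIdeal_iff_eval.1 h _ (rep_mem_affineCone_iff.2 hx))

theorem zeroLocus_vanishingIdeal_affineCone_subset (hT : IsClosed T) (hne : T.Nonempty) :
    zeroLocus ℂ (vanishingIdeal ℂ (affineCone T)) ⊆ affineCone T := by
  intro v hv
  by_cases hv0 : v = 0
  · exact hv0 ▸ zero_mem_affineCone hne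
  obtain ⟨a, ha⟩ := Projectivization.exists_smul_eq_mk_rep ℂ v hv0
  have hva : v = (a⁻¹ : ℂˣ) • (Projectivization.mk ℂ v hv0).rep := by rw [← ha, inv_smul_smul]
  suffices h : Projectivization.mk ℂ v hv0 ∈ T from ⟨_, h, _, hva.symm⟩
  by_contra h
  obtain ⟨f, n, hf, hfx, hfT⟩ := exists_isHomogeneous_of_mem_isOpen hT.isOpen_compl h
  have hfv : eval v f = 0 := by
    simpa [aeval_eq_eval] using hv f
      (mem_vanishingIdeal_affineCone hf fun y hy ↦ hfT y (not_not.2 hy))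
  rw [← ha, Units.smul_def, hf.eval_smul, hfv, mul_zero] at hfx
  exact hfx rfl

/-- The affine cone over a set of projective dimension at least three has codimension at
most two. -/
theorem not_lt_vanishingIdeal_affineCone (hdim : (3 : ℕ) ≤ topologicalKrullDim T)
    {P Q R : Ideal (MvPolynomial (Fin 6) ℂ)} (hP : P.IsPrime) (hQ : Q.IsPrime) (hR : R.IsPrime)
    (hPQ : P < Q) (hQR : Q < R) : ¬ R < vanishingIdeal ℂ (affineCone T) := by
  intro hRT
  obtain ⟨l, hl⟩ := Order.le_krullDim_iff.1 hdim
  let J (A : TopologicalSpace.IrreducibleCloseds T) : PrimeSpectrum (MvPolynomial (Fin 6) ℂ) :=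
    ⟨vanishingIdeal ℂ (affineCone (Subtype.val '' (A : Set T))),
      isPrime_vanishingIdeal_affineCone
        (A.isIrreducible.image _ continuous_subtype_val.continuousOn)⟩
  have hJ : StrictAnti J := by
    intro A B hAB
    obtain ⟨hle, x, hxB, hxA⟩ := SetLike.lt_iff_le_and_exists.1 hAB
    obtain ⟨Z, hZ, hAZ⟩ := isClosed_induced_iff.1 A.isClosed
    refine vanishingIdeal_affineCone_lt (Set.image_mono hle) hZ ?_ ⟨x, hxB, rfl⟩ ?_
    · rw [Set.image_subset_iff, hAZ]
    · rw [← Set.mem_preimage, hAZ]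
      exact hxA
  let M : PrimeSpectrum (MvPolynomial (Fin 6) ℂ) :=
    ⟨_, isPrime_vanishingIdeal_submodule (⊥ : Submodule ℂ (Fin 6 → ℂ))⟩
  have hM (A : TopologicalSpace.IrreducibleCloseds T) : J A < M :=
    vanishingIdeal_affineCone_lt_vanishingIdeal_bot (A.isIrreducible.nonempty.image _)
  have hRJ (A : TopologicalSpace.IrreducibleCloseds T) : (⟨R, hR⟩ : PrimeSpectrum _) < J A :=
    hRT.trans_le (vanishingIdeal_anti_mono (affineCone_mono (Subtype.coe_image_subset T _)))
  have hl' {i j : ℕ} (hij : i < j) (hj : j < 4) :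
      J (l ⟨j, by lia⟩) < J (l ⟨i, by lia⟩) :=
    hJ (LTSeries.strictMono l hij)
  let c : LTSeries (PrimeSpectrum (MvPolynomial (Fin 6) ℂ)) := LTSeries.mk 7
    ![⟨P, hP⟩, ⟨Q, hQ⟩, ⟨R, hR⟩, J (l ⟨3, by lia⟩), J (l ⟨2, by lia⟩), J (l ⟨1, by lia⟩),
      J (l ⟨0, by lia⟩), M] <| Fin.strictMono_iff_lt_succ.2 fun i ↦ by
        fin_cases i
        exacts [hPQ, hQR, hRJ _, hl' (by lia) (by lia), hl' (by lia) (by lia),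
          hl' (by lia) (by lia), hM _]
  have hc := length_primeSpectrum_mvPolynomial_le c
  simp [c] at hc

theorem isClosed_singLocus {F : MvPolynomial (Fin 6) ℂ} {n : ℕ} (hF : F.IsHomogeneous n) :
    IsClosed (singLocus F) := by
  have : singLocus F = ⋂ i, {x | eval x.rep (pderiv i F) ≠ 0}ᶜ := by
    ext x
    simp [singLocus]
  rw [this]
  exact isClosed_iInter fun i ↦ (isOpen_eval_rep_ne_zero hF.pderiv).isClosed_compl

theorem eval_pderiv_eq_zero_of_mem_affineCone {F : MvPolynomial (Fin 6) ℂ} {n : ℕ}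
    (hF : F.IsHomogeneous n) {v : Fin 6 → ℂ} (hv : v ∈ affineCone (singLocus F)) (i : Fin 6) :
    eval v (pderiv i F) = 0 := by
  obtain ⟨x, hx, t, rfl⟩ := hv
  rw [hF.pderiv.eval_smul, hx i, mul_zero]

/-- A three-dimensional irreducible component of the singular locus of an irreducible cubic is the
projectivization of a four-dimensional linear subspace. -/
theorem exists_affineCone_eq_submodule {F : MvPolynomial (Fin 6) ℂ} (hFirr : Irreducible F)
    (hF : F.IsHomogeneous 3) (hT : IsIrredComponentOf (singLocus F) T)
    (hdim : projDim T = ((3 : ℕ∞) : WithBot ℕ∞)) :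
    ∃ V : Submodule ℂ (Fin 6 → ℂ), Module.finrank ℂ V = 4 ∧ affineCone T = V := by
  obtain ⟨hTS, hirr, hmax⟩ := hT
  have hclosed : IsClosed T := by
    rw [← hmax _ (closure_minimal hTS (isClosed_singLocus hF)) hirr.closure subset_closure]
    exact isClosed_closure
  have hne := hirr.nonempty
  obtain ⟨V, hV, h⟩ := eq_submodule_of_secant_vanishing hFirr
    (by rw [hF.totalDegree hFirr.ne_zero]; lia)
    (isPrime_vanishingIdeal_affineCone hirr)
    (zeroLocus_vanishingIdeal_affineCone_subset hclosed hne) (zero_mem_affineCone hne)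
    (fun x hx p hp t ↦ eval_add_eq_zero_of_singular hF
      (eval_pderiv_eq_zero_of_mem_affineCone hF (affineCone_mono hTS hx)) fun i ↦ by
        rw [hF.pderiv.eval_smul,
          eval_pderiv_eq_zero_of_mem_affineCone hF (affineCone_mono hTS hp), mul_zero])
    (fun _ _ _ ↦ not_lt_vanishingIdeal_affineCone hdim.ge)
  exact ⟨V, by simpa using hV, h⟩

end Cone
theorem irreducible_cubic_threedim_singular_locus
    (F : MvPolynomial (Fin 6) ℂ) (hFirr : Irreducible F) (hF : F.IsHomogeneous 3)
    (hdim : projDim (singLocus F) = ((3 : ℕ∞) : WithBot ℕ∞)) :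
    (∃! T : Set (Projectivization ℂ (Fin 6 → ℂ)),
        IsIrredComponentOf (singLocus F) T ∧ projDim T = ((3 : ℕ∞) : WithBot ℕ∞)) ∧
    (∀ T : Set (Projectivization ℂ (Fin 6 → ℂ)),
        IsIrredComponentOf (singLocus F) T → projDim T = ((3 : ℕ∞) : WithBot ℕ∞) →
        ∃ V : Submodule ℂ (Fin 6 → ℂ), Module.finrank ℂ V = 4 ∧
          T = {x | x.rep ∈ V}) ∧
    (∃ W : Submodule ℂ (Fin 6 → ℂ), Module.finrank ℂ W = 3 ∧
      ∀ w ∈ W, eval w F = 0) := by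
  let := zarTop
  have hvanish {T₁ T₂ : Set (Projectivization ℂ (Fin 6 → ℂ))} (h₁ : T₁ ⊆ singLocus F)
      (h₂ : T₂ ⊆ singLocus F) {v w : Fin 6 → ℂ} (hv : v ∈ affineCone T₁)
      (hw : w ∈ affineCone T₂) : eval (v + w) F = 0 :=
    eval_add_eq_zero_of_singular hF
      (eval_pderiv_eq_zero_of_mem_affineCone hF (affineCone_mono h₁ hv))
      (eval_pderiv_eq_zero_of_mem_affineCone hF (affineCone_mono h₂ hw))
  obtain ⟨T, hTS, hirr, hmax, hle⟩ :=
    exists_maximal_isIrreducible_of_le_topologicalKrullDim (n := 3) hdim.ge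
  have hT : IsIrredComponentOf (singLocus F) T := ⟨hTS, hirr, hmax⟩
  have hTdim : projDim T = ((3 : ℕ∞) : WithBot ℕ∞) :=
    le_antisymm (hdim ▸ (Topology.IsEmbedding.inclusion hTS).isInducing.topologicalKrullDim_le) hle
  obtain ⟨V, hV, hTV⟩ := exists_affineCone_eq_submodule hFirr hF hT hTdim
  refine ⟨⟨T, ⟨hT, hTdim⟩, fun T' ⟨hT', hdim'⟩ ↦ ?_⟩, fun T' hT' hdim' ↦ ?_, ?_⟩
  · obtain ⟨V', hV', hTV'⟩ := exists_affineCone_eq_submodule hFirr hF hT' hdim'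
    have hsup : Module.finrank ℂ (V ⊔ V' : Submodule ℂ (Fin 6 → ℂ)) + 2 ≤ Fintype.card (Fin 6) := by
      refine finrank_add_two_le_of_vanishing hFirr
        (by rw [hF.totalDegree hFirr.ne_zero]; lia) fun x hx ↦ ?_
      obtain ⟨v, hv, w, hw, rfl⟩ := Submodule.mem_sup.1 hx
      exact hvanish hTS hT'.1 (hTV ▸ hv) (hTV' ▸ hw)
    rw [Fintype.card_fin] at hsup
    have hVV' : V = V' :=
      (Submodule.eq_of_le_of_finrank_le le_sup_left (by lia)).trans
        (Submodule.eq_of_le_of_finrank_le le_sup_right (by lia)).symm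
    ext x
    rw [← rep_mem_affineCone_iff, hTV', ← hVV', ← hTV, rep_mem_affineCone_iff]
  · obtain ⟨V', hV', hTV'⟩ := exists_affineCone_eq_submodule hFirr hF hT' hdim'
    refine ⟨V', hV', Set.ext fun x ↦ ?_⟩
    rw [← rep_mem_affineCone_iff, hTV']
    rfl
  · obtain ⟨f, hf⟩ := exists_linearIndependent_of_le_finrank (R := ℂ) (M := V) (n := 3) (by lia)
    refine ⟨Submodule.span ℂ (Set.range (V.subtype ∘ f)), ?_, fun w hw ↦ ?_⟩
    · simpa using finrank_span_eq_card (hf.map' V.subtype V.ker_subtype)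
    · have hwV : w ∈ V := by
        refine Submodule.span_le.2 ?_ hw
        rintro _ ⟨i, rfl⟩
        exact (f i).2
      simpa using hvanish hTS hTS (v := w) (w := 0) (hTV ▸ hwV) (hTV ▸ V.zero_mem)
end

section
/- Let F, G ∈ ℂ[X₀,…,X₄] be homogeneous of degrees 2 and 3 respectively, with F ≠ 0 and with P = F·Z + G ∈ ℂ[X₀,…,X₄,Z] an irreducible polynomial (so Y = V(P) ⊂ ℙ⁵ is an irreducible reduced cubic hypersurface that is not a cone with vertex p = [0:…:0:1]). Then Y contains a projective plane if and only if the surface S = V(F,G) ⊂ ℙ⁴ contains a line or a conic; that is, if and only if there exists a 2-dimensional linear subspace L ⊂ ℂ⁵ with L in the affine cone over S, or there exist a 3-dimensional linear subspace W ⊂ ℂ⁵ and a nonzero quadratic form q on W such that {[w] ∈ ℙ(W) : q(w) = 0} ⊆ S. -/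
open MvPolynomial

/-- A property of functions that is closed under linear combinations and holds for all products of
`n` coordinates holds for every form of degree `n`. -/
lemma MvPolynomial.IsHomogeneous.eval_induction {σ : Type*} {n : ℕ} {F : MvPolynomial σ ℂ}
    (hF : F.IsHomogeneous n) (p : ((σ → ℂ) → ℂ) → Prop) (hzero : p fun _ => 0)
    (hadd : ∀ f g, p f → p g → p fun x => f x + g x)
    (hsmul : ∀ (c : ℂ) f, p f → p fun x => c * f x)
    (hprod : ∀ s : Multiset σ, s.card = n → p fun x => (s.map x).prod) :
    p fun x => eval x F := by
  classical
  have key : ∀ S : Finset (σ →₀ ℕ), S ⊆ F.support →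
      p fun x => ∑ d ∈ S, coeff d F * d.prod fun i k => x i ^ k := by
    intro S
    induction S using Finset.induction_on with
    | empty => intro _; simpa using hzero
    | insert d S hd ih =>
      intro hS
      simp only [Finset.sum_insert hd]
      refine hadd _ _ (hsmul _ _ ?_) (ih fun e he => hS (Finset.mem_insert_of_mem he))
      have hdF : coeff d F ≠ 0 := mem_support_iff.mp (hS (Finset.mem_insert_self _ _))
      have hcard : d.toMultiset.card = n := by
        rw [Finsupp.card_toMultiset, ← hF hdF]
        exact DFunLike.congr_fun Finsupp.degree_eq_weight_one d
      convert hprod _ hcard using 2 with x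
      rw [Finsupp.toMultiset_map, Finsupp.prod_toMultiset, Finsupp.prod_mapDomain_index]
      · simp
      · intros; exact pow_add _ _ _
  exact key F.support subset_rfl

lemma exists_quadraticForm_eq_eval {σ : Type*} {F : MvPolynomial σ ℂ} (hF : F.IsHomogeneous 2) :
    ∃ Q : QuadraticForm ℂ (σ → ℂ), ∀ x, Q x = eval x F := by
  refine hF.eval_induction (fun f => ∃ Q : QuadraticForm ℂ (σ → ℂ), ∀ x, Q x = f x)
    ⟨0, fun _ => rfl⟩ ?_ ?_ ?_
  · rintro f g ⟨Q, hQ⟩ ⟨R, hR⟩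
    exact ⟨Q + R, fun x => by simp [hQ, hR]⟩
  · rintro c f ⟨Q, hQ⟩
    exact ⟨c • Q, fun x => by simp [hQ]⟩
  · intro s hs
    obtain ⟨i, j, rfl⟩ := Multiset.card_eq_two.mp hs
    exact ⟨QuadraticMap.linMulLin (LinearMap.proj i) (LinearMap.proj j), fun x => by simp⟩

lemma linearMap_fin_three_apply {σ : Type*} (φ : (Fin 3 → ℂ) →ₗ[ℂ] (σ → ℂ)) (y : Fin 3 → ℂ)
    (i : σ) :
    φ y i = y 0 * φ (Pi.single 0 1) i + y 1 * φ (Pi.single 1 1) i + y 2 * φ (Pi.single 2 1) i := by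
  conv_lhs => rw [pi_eq_sum_univ' y]
  simp [Fin.sum_univ_three]

lemma exists_coeffs_of_isHomogeneous_two {σ : Type*} {F : MvPolynomial σ ℂ}
    (hF : F.IsHomogeneous 2) (φ : (Fin 3 → ℂ) →ₗ[ℂ] (σ → ℂ)) :
    ∃ a b c d e f : ℂ, ∀ y, eval (φ y) F =
      a * y 0 ^ 2 + b * y 1 ^ 2 + c * y 2 ^ 2 + d * (y 0 * y 1) + e * (y 0 * y 2)
        + f * (y 1 * y 2) := by
  refine hF.eval_induction (fun h => ∃ a b c d e f : ℂ, ∀ y, h (φ y) =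
      a * y 0 ^ 2 + b * y 1 ^ 2 + c * y 2 ^ 2 + d * (y 0 * y 1) + e * (y 0 * y 2)
        + f * (y 1 * y 2)) ⟨0, 0, 0, 0, 0, 0, fun _ => by simp⟩ ?_ ?_ ?_
  · rintro h k ⟨a, b, c, d, e, f, hh⟩ ⟨a', b', c', d', e', f', hk⟩
    exact ⟨a + a', b + b', c + c', d + d', e + e', f + f', fun y => by beta_reduce; rw [hh, hk]; ring⟩
  · rintro r h ⟨a, b, c, d, e, f, hh⟩
    exact ⟨r * a, r * b, r * c, r * d, r * e, r * f, fun y => by beta_reduce; rw [hh]; ring⟩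
  · intro s hs
    obtain ⟨i, j, rfl⟩ := Multiset.card_eq_two.mp hs
    let u := fun k => φ (Pi.single k 1)
    refine ⟨u 0 i * u 0 j, u 1 i * u 1 j, u 2 i * u 2 j, u 0 i * u 1 j + u 1 i * u 0 j,
      u 0 i * u 2 j + u 2 i * u 0 j, u 1 i * u 2 j + u 2 i * u 1 j, fun y => ?_⟩
    simp only [Multiset.insert_eq_cons, Multiset.map_cons, Multiset.map_singleton,
      Multiset.prod_cons, Multiset.prod_singleton]
    rw [linearMap_fin_three_apply φ y i, linearMap_fin_three_apply φ y j]
    ring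

lemma exists_coeffs_of_isHomogeneous_three {σ : Type*} {G : MvPolynomial σ ℂ}
    (hG : G.IsHomogeneous 3) (φ : (Fin 3 → ℂ) →ₗ[ℂ] (σ → ℂ)) :
    ∃ a b c d e f g h k l : ℂ, ∀ y, eval (φ y) G =
      a * y 0 ^ 3 + b * y 1 ^ 3 + c * y 2 ^ 3 + d * (y 0 ^ 2 * y 1) + e * (y 0 ^ 2 * y 2)
        + f * (y 1 ^ 2 * y 0) + g * (y 1 ^ 2 * y 2) + h * (y 2 ^ 2 * y 0) + k * (y 2 ^ 2 * y 1)
        + l * (y 0 * y 1 * y 2) := by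
  refine hG.eval_induction (fun m => ∃ a b c d e f g h k l : ℂ, ∀ y, m (φ y) =
      a * y 0 ^ 3 + b * y 1 ^ 3 + c * y 2 ^ 3 + d * (y 0 ^ 2 * y 1) + e * (y 0 ^ 2 * y 2)
        + f * (y 1 ^ 2 * y 0) + g * (y 1 ^ 2 * y 2) + h * (y 2 ^ 2 * y 0) + k * (y 2 ^ 2 * y 1)
        + l * (y 0 * y 1 * y 2))
    ⟨0, 0, 0, 0, 0, 0, 0, 0, 0, 0, fun _ => by simp⟩ ?_ ?_ ?_
  · rintro m n ⟨a, b, c, d, e, f, g, h, k, l, hm⟩ ⟨a', b', c', d', e', f', g', h', k', l', hn⟩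
    exact ⟨a + a', b + b', c + c', d + d', e + e', f + f', g + g', h + h', k + k', l + l',
      fun y => by beta_reduce; rw [hm, hn]; ring⟩
  · rintro r m ⟨a, b, c, d, e, f, g, h, k, l, hm⟩
    exact ⟨r * a, r * b, r * c, r * d, r * e, r * f, r * g, r * h, r * k, r * l,
      fun y => by beta_reduce; rw [hm]; ring⟩
  · intro s hs
    obtain ⟨i, j, k, rfl⟩ := Multiset.card_eq_three.mp hs
    let u := fun k => φ (Pi.single k 1)
    refine ⟨u 0 i * u 0 j * u 0 k, u 1 i * u 1 j * u 1 k, u 2 i * u 2 j * u 2 k,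
      u 0 i * u 0 j * u 1 k + u 0 i * u 1 j * u 0 k + u 1 i * u 0 j * u 0 k,
      u 0 i * u 0 j * u 2 k + u 0 i * u 2 j * u 0 k + u 2 i * u 0 j * u 0 k,
      u 1 i * u 1 j * u 0 k + u 1 i * u 0 j * u 1 k + u 0 i * u 1 j * u 1 k,
      u 1 i * u 1 j * u 2 k + u 1 i * u 2 j * u 1 k + u 2 i * u 1 j * u 1 k,
      u 2 i * u 2 j * u 0 k + u 2 i * u 0 j * u 2 k + u 0 i * u 2 j * u 2 k,
      u 2 i * u 2 j * u 1 k + u 2 i * u 1 j * u 2 k + u 1 i * u 2 j * u 2 k,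
      u 0 i * u 1 j * u 2 k + u 0 i * u 2 j * u 1 k + u 1 i * u 0 j * u 2 k
        + u 1 i * u 2 j * u 0 k + u 2 i * u 0 j * u 1 k + u 2 i * u 1 j * u 0 k, fun y => ?_⟩
    simp only [Multiset.insert_eq_cons, Multiset.map_cons, Multiset.map_singleton,
      Multiset.prod_cons, Multiset.prod_singleton]
    rw [linearMap_fin_three_apply φ y i, linearMap_fin_three_apply φ y j,
      linearMap_fin_three_apply φ y k]
    ring

lemma eval_eq_mul_of_eval_conic_eq_zero_two {σ : Type*} {F : MvPolynomial σ ℂ}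
    (hF : F.IsHomogeneous 2) (φ : (Fin 3 → ℂ) →ₗ[ℂ] (σ → ℂ))
    (h0 : ∀ s t : ℂ, eval (φ ![s ^ 2, s * t, t ^ 2]) F = 0) :
    ∃ b : ℂ, ∀ y, eval (φ y) F = b * (y 1 ^ 2 - y 0 * y 2) := by
  obtain ⟨a, b, c, d, e, f, h⟩ := exists_coeffs_of_isHomogeneous_two hF φ
  have key : ∀ s t : ℂ, a * s ^ 4 + d * (s ^ 3 * t) + (b + e) * (s ^ 2 * t ^ 2)
      + f * (s * t ^ 3) + c * t ^ 4 = 0 := by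
    intro s t
    rw [← h0 s t, h]
    simp
    ring
  have h1 := key 1 0
  have h2 := key 0 1
  have h3 := key 1 1
  have h4 := key (-1) 1
  have h5 := key 2 1
  have ha : a = 0 := by linear_combination h1
  have hc : c = 0 := by linear_combination h2
  have he : b + e = 0 := by grind
  have hd : d = 0 := by grind
  have hf : f = 0 := by grind
  exact ⟨b, fun y => by rw [h, ha, hc, hd, hf]; linear_combination y 0 * y 2 * he⟩

lemma eval_eq_mul_of_eval_conic_eq_zero_three {σ : Type*} {G : MvPolynomial σ ℂ}
    (hG : G.IsHomogeneous 3) (φ : (Fin 3 → ℂ) →ₗ[ℂ] (σ → ℂ))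
    (h0 : ∀ s t : ℂ, eval (φ ![s ^ 2, s * t, t ^ 2]) G = 0) :
    ∃ ℓ : (Fin 3 → ℂ) →ₗ[ℂ] ℂ, ∀ y, eval (φ y) G = ℓ y * (y 1 ^ 2 - y 0 * y 2) := by
  obtain ⟨a, b, c, d, e, f, g, h, k, l, H⟩ := exists_coeffs_of_isHomogeneous_three hG φ
  have key : ∀ s t : ℂ, a * s ^ 6 + d * (s ^ 5 * t) + (e + f) * (s ^ 4 * t ^ 2)
      + (b + l) * (s ^ 3 * t ^ 3) + (g + h) * (s ^ 2 * t ^ 4) + k * (s * t ^ 5)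
      + c * t ^ 6 = 0 := by
    intro s t
    rw [← h0 s t, H]
    simp
    ring
  have h1 := key 1 0
  have h2 := key 0 1
  have h3 := key 1 1
  have h4 := key (-1) 1
  have h5 := key 2 1
  have h6 := key (-2) 1
  have h7 := key 3 1
  have ha : a = 0 := by linear_combination h1
  have hc : c = 0 := by linear_combination h2
  have hef : e + f = 0 := by grind
  have hgh : g + h = 0 := by grind
  have hd : d = 0 := by grind
  have hk : k = 0 := by grind
  have hbl : b + l = 0 := by grind
  refine ⟨f • LinearMap.proj 0 + b • LinearMap.proj 1 + g • LinearMap.proj 2, fun y => ?_⟩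
  rw [H, ha, hc, hd, hk]
  simp
  linear_combination y 0 ^ 2 * y 2 * hef + y 2 ^ 2 * y 0 * hgh + y 0 * y 1 * y 2 * hbl

lemma Submodule.exists_le_finrank_eq {V : Type*} [AddCommGroup V] [Module ℂ V]
    [FiniteDimensional ℂ V] (S : Submodule ℂ V) {n : ℕ} (hn : n ≤ Module.finrank ℂ S) :
    ∃ T ≤ S, Module.finrank ℂ T = n := by
  let v : Fin n → V := fun i => Module.finBasis ℂ S (Fin.castLE hn i)
  have hv : LinearIndependent ℂ v :=
    ((Module.finBasis ℂ S).linearIndependent.comp _ (Fin.castLE_injective hn)).map' S.subtype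
      S.ker_subtype
  refine ⟨Submodule.span ℂ (Set.range v), ?_, by simpa using finrank_span_eq_card hv⟩
  rw [Submodule.span_le]
  rintro _ ⟨i, rfl⟩
  exact Subtype.property _

lemma exists_weighted_isotropic (a b : ℂ) :
    ∃ s t : ℂ, (s ≠ 0 ∨ t ≠ 0) ∧ a * s ^ 2 + b * t ^ 2 = 0 := by
  by_cases ha : a = 0
  · exact ⟨1, 0, by simp, by simp [ha]⟩
  · obtain ⟨r, hr⟩ := IsAlgClosed.exists_pow_nat_eq (-b / a) (n := 2) (by norm_num)
    exact ⟨r, 1, by simp, by rw [hr]; field_simp; ring⟩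

/-- A quadratic form in three variables over `ℂ` either vanishes on a plane through the origin or
vanishes on a linearly embedded copy of the conic `y₁² = y₀y₂`. -/
lemma QuadraticForm.exists_isotropic_plane_or_conic {V : Type*} [AddCommGroup V] [Module ℂ V]
    (hV : Module.finrank ℂ V = 3) (q : QuadraticForm ℂ V) :
    (∃ ψ : (Fin 2 → ℂ) →ₗ[ℂ] V, Function.Injective ψ ∧ ∀ y, q (ψ y) = 0) ∨
    (∃ ψ : (Fin 3 → ℂ) →ₗ[ℂ] V, Function.Injective ψ ∧
      ∀ s t : ℂ, q (ψ ![s ^ 2, s * t, t ^ 2]) = 0) := by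
  have : FiniteDimensional ℂ V := Module.finite_of_finrank_pos (by omega)
  have hw := QuadraticForm.equivalent_weightedSumSquares q
  rw [hV] at hw
  obtain ⟨w, ⟨e⟩⟩ := hw
  have hq : ∀ x, q (e.symm.toLinearEquiv x) = w 0 * x 0 ^ 2 + w 1 * x 1 ^ 2 + w 2 * x 2 ^ 2 := by
    intro x
    refine (e.symm.map_app x).trans ?_
    rw [QuadraticMap.weightedSumSquares_apply, Fin.sum_univ_three]
    simp [pow_two]
  have line : ∀ M : Matrix (Fin 3) (Fin 2) ℂ, (∀ y, M.mulVec y = 0 → y = 0) →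
      (∀ y, w 0 * M.mulVec y 0 ^ 2 + w 1 * M.mulVec y 1 ^ 2 + w 2 * M.mulVec y 2 ^ 2 = 0) →
      ∃ ψ : (Fin 2 → ℂ) →ₗ[ℂ] V, Function.Injective ψ ∧ ∀ y, q (ψ y) = 0 := by
    intro M hM h
    refine ⟨e.symm.toLinearEquiv.toLinearMap ∘ₗ M.mulVecLin, ?_, fun y => ?_⟩
    · exact e.symm.toLinearEquiv.injective.comp ((injective_iff_map_eq_zero _).mpr hM)
    · exact (hq _).trans (h y)
  by_cases h0 : w 0 = 0
  · obtain ⟨s, t, hst, h⟩ := exists_weighted_isotropic (w 1) (w 2)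
    refine Or.inl (line !![1, 0; 0, s; 0, t] ?_ ?_)
    · intro y hy
      have h1 := congrFun hy 0
      have h2 := congrFun hy 1
      have h3 := congrFun hy 2
      simp [Matrix.mulVec, dotProduct] at h1 h2 h3
      ext i
      fin_cases i <;> simp <;> grind
    · intro y
      simp [Matrix.mulVec, dotProduct]
      linear_combination y 0 ^ 2 * h0 + y 1 ^ 2 * h
  by_cases h1 : w 1 = 0
  · obtain ⟨s, t, hst, h⟩ := exists_weighted_isotropic (w 0) (w 2)
    refine Or.inl (line !![0, s; 1, 0; 0, t] ?_ ?_)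
    · intro y hy
      have h1 := congrFun hy 0
      have h2 := congrFun hy 1
      have h3 := congrFun hy 2
      simp [Matrix.mulVec, dotProduct] at h1 h2 h3
      ext i
      fin_cases i <;> simp <;> grind
    · intro y
      simp [Matrix.mulVec, dotProduct]
      linear_combination y 0 ^ 2 * h1 + y 1 ^ 2 * h
  by_cases h2 : w 2 = 0
  · obtain ⟨s, t, hst, h⟩ := exists_weighted_isotropic (w 0) (w 1)
    refine Or.inl (line !![0, s; 0, t; 1, 0] ?_ ?_)
    · intro y hy
      have h1 := congrFun hy 0
      have h2 := congrFun hy 1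
      have h3 := congrFun hy 2
      simp [Matrix.mulVec, dotProduct] at h1 h2 h3
      ext i
      fin_cases i <;> simp <;> grind
    · intro y
      simp [Matrix.mulVec, dotProduct]
      linear_combination y 0 ^ 2 * h2 + y 1 ^ 2 * h
  right
  obtain ⟨α, hα⟩ := IsAlgClosed.exists_pow_nat_eq (w 0)⁻¹ (n := 2) (by norm_num)
  obtain ⟨β, hβ⟩ := IsAlgClosed.exists_pow_nat_eq (w 1)⁻¹ (n := 2) (by norm_num)
  obtain ⟨γ, hγ⟩ := IsAlgClosed.exists_pow_nat_eq (-(w 2)⁻¹) (n := 2) (by norm_num)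
  have hα0 : w 0 * α ^ 2 = 1 := by rw [hα]; field_simp
  have hβ0 : w 1 * β ^ 2 = 1 := by rw [hβ]; field_simp
  have hγ0 : w 2 * γ ^ 2 = -1 := by rw [hγ]; field_simp
  let M : Matrix (Fin 3) (Fin 3) ℂ := !![α, 0, -α; 0, 2 * β, 0; γ, 0, γ]
  refine ⟨e.symm.toLinearEquiv.toLinearMap ∘ₗ M.mulVecLin, ?_, fun s t => ?_⟩
  · refine e.symm.toLinearEquiv.injective.comp ((injective_iff_map_eq_zero _).mpr fun y hy => ?_)
    have h3 := congrFun hy 0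
    have h4 := congrFun hy 1
    have h5 := congrFun hy 2
    simp [M, Matrix.mulVec, dotProduct, Fin.sum_univ_three] at h3 h4 h5
    have hα1 : α ≠ 0 := by rintro rfl; simp at hα0
    have hβ1 : β ≠ 0 := by rintro rfl; simp at hβ0
    have hγ1 : γ ≠ 0 := by rintro rfl; simp at hγ0
    have h6 : y 0 - y 2 = 0 := mul_left_cancel₀ hα1 (by linear_combination h3)
    have h7 : y 0 + y 2 = 0 := mul_left_cancel₀ hγ1 (by linear_combination h5)
    ext i
    fin_cases i <;> simp <;> grind
  · refine (hq _).trans ?_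
    simp [M, Matrix.mulVec, dotProduct, Fin.sum_univ_three]
    linear_combination (s ^ 2 - t ^ 2) ^ 2 * hα0 + 4 * s ^ 2 * t ^ 2 * hβ0
      + (s ^ 2 + t ^ 2) ^ 2 * hγ0

lemma eval_rename_castSucc_mul_X_add (F G : MvPolynomial (Fin 5) ℂ) (x : Fin 6 → ℂ) :
    eval x (rename Fin.castSucc F * X (5 : Fin 6) + rename Fin.castSucc G) =
      eval (x ∘ Fin.castSucc) F * x 5 + eval (x ∘ Fin.castSucc) G := by
  simp [eval_rename]

/-- The projection of `ℂ⁶` that forgets the last coordinate. -/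
def forgetLast : (Fin 6 → ℂ) →ₗ[ℂ] (Fin 5 → ℂ) := LinearMap.funLeft ℂ ℂ Fin.castSucc

lemma eq_zero_of_forgetLast_eq_zero {x : Fin 6 → ℂ} (h : forgetLast x = 0) (h5 : x 5 = 0) :
    x = 0 := by
  ext i
  induction i using Fin.lastCases with
  | last => exact h5
  | cast i => exact congrFun h i

lemma forgetLast_surjective : Function.Surjective forgetLast := fun y =>
  ⟨Fin.snoc y 0, by ext i; simp [forgetLast, LinearMap.funLeft_apply]⟩

lemma forgetLast_single : forgetLast (Pi.single 5 1) = 0 := by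
  ext i
  fin_cases i <;> rfl

lemma eq_smul_single_of_forgetLast_eq_zero {x : Fin 6 → ℂ} (h : forgetLast x = 0) :
    x = x 5 • Pi.single 5 1 := by
  rw [← sub_eq_zero]
  apply eq_zero_of_forgetLast_eq_zero
  · rw [map_sub, map_smul, forgetLast_single, h]
    simp
  · simp

lemma finrank_map_forgetLast_of_mem {W : Submodule ℂ (Fin 6 → ℂ)} (hW : Pi.single 5 1 ∈ W) :
    Module.finrank ℂ (W.map forgetLast) + 1 = Module.finrank ℂ W := by
  have h := (forgetLast.domRestrict W).finrank_range_add_finrank_ker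
  rw [LinearMap.range_domRestrict] at h
  rw [← h, add_right_inj, eq_comm]
  refine finrank_eq_one (⟨⟨_, hW⟩, forgetLast_single⟩ : LinearMap.ker (forgetLast.domRestrict W))
    ?_ ?_
  · intro h0
    have h1 := congrFun (congrArg Subtype.val (congrArg Subtype.val h0)) 5
    simp at h1
  · rintro ⟨⟨x, hx⟩, hx0⟩
    exact ⟨x 5, Subtype.ext (Subtype.ext (eq_smul_single_of_forgetLast_eq_zero hx0).symm)⟩

lemma finrank_map_forgetLast_of_notMem {W : Submodule ℂ (Fin 6 → ℂ)} (hW : Pi.single 5 1 ∉ W) :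
    Module.finrank ℂ (W.map forgetLast) = Module.finrank ℂ W := by
  rw [← LinearMap.range_domRestrict]
  refine LinearMap.finrank_range_of_inj ((injective_iff_map_eq_zero _).mpr ?_)
  rintro ⟨x, hx⟩ hx0
  have h := eq_smul_single_of_forgetLast_eq_zero hx0
  by_cases h5 : x 5 = 0
  · rw [h5, zero_smul] at h
    exact Subtype.ext h
  · refine absurd ?_ hW
    rw [h] at hx
    exact (Submodule.smul_mem_iff W h5).mp hx

/-- The cone over a line contained in `V(F, G)` is a plane in the cubic. -/
lemma exists_plane_of_line {F G : MvPolynomial (Fin 5) ℂ} {L : Submodule ℂ (Fin 5 → ℂ)}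
    (hL : Module.finrank ℂ L = 2) (h : ∀ x ∈ L, eval x F = 0 ∧ eval x G = 0) :
    ∃ W : Submodule ℂ (Fin 6 → ℂ), Module.finrank ℂ W = 3 ∧
      ∀ w ∈ W, eval (forgetLast w) F * w 5 + eval (forgetLast w) G = 0 := by
  refine ⟨L.comap forgetLast, ?_, fun w hw => ?_⟩
  · rw [← finrank_map_forgetLast_of_mem, Submodule.map_comap_eq_of_surjective
      forgetLast_surjective, hL]
    rw [Submodule.mem_comap, forgetLast_single]
    exact L.zero_mem
  · obtain ⟨h1, h2⟩ := h _ hw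
    rw [h1, h2]
    ring

/-- The graph of a linear form over an embedded plane. -/
lemma exists_plane_of_graph {F G : MvPolynomial (Fin 5) ℂ} {φ : (Fin 3 → ℂ) →ₗ[ℂ] (Fin 5 → ℂ)}
    (hφ : Function.Injective φ) (m : (Fin 3 → ℂ) →ₗ[ℂ] ℂ)
    (h : ∀ y, eval (φ y) F * m y + eval (φ y) G = 0) :
    ∃ W : Submodule ℂ (Fin 6 → ℂ), Module.finrank ℂ W = 3 ∧
      ∀ w ∈ W, eval (forgetLast w) F * w 5 + eval (forgetLast w) G = 0 := by
  let ψ : (Fin 3 → ℂ) →ₗ[ℂ] (Fin 6 → ℂ) :=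
    LinearMap.pi (Fin.snoc (α := fun _ => (Fin 3 → ℂ) →ₗ[ℂ] ℂ) (fun i => LinearMap.proj i ∘ₗ φ) m)
  have h1 : ∀ y, forgetLast (ψ y) = φ y := fun y => by
    ext i
    simp [ψ, forgetLast, LinearMap.funLeft_apply]
  have h2 : ∀ y, ψ y 5 = m y := fun y => by
    change Fin.snoc (α := fun _ => (Fin 3 → ℂ) →ₗ[ℂ] ℂ) _ m (Fin.last 5) y = m y
    rw [Fin.snoc_last]
  refine ⟨LinearMap.range ψ, ?_, ?_⟩
  · rw [LinearMap.finrank_range_of_inj]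
    · simp
    · intro y z hyz
      exact hφ (by rw [← h1, ← h1, hyz])
  · rintro _ ⟨y, rfl⟩
    rw [h1, h2, h]

/-- A smooth conic contained in `V(F, G)` yields a plane in the cubic. -/
lemma exists_plane_of_conic {F G : MvPolynomial (Fin 5) ℂ}
    (hF : F.IsHomogeneous 2) (hG : G.IsHomogeneous 3) {φ : (Fin 3 → ℂ) →ₗ[ℂ] (Fin 5 → ℂ)}
    (hφ : Function.Injective φ)
    (h : ∀ s t : ℂ, eval (φ ![s ^ 2, s * t, t ^ 2]) F = 0 ∧
      eval (φ ![s ^ 2, s * t, t ^ 2]) G = 0) :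
    ∃ W : Submodule ℂ (Fin 6 → ℂ), Module.finrank ℂ W = 3 ∧
      ∀ w ∈ W, eval (forgetLast w) F * w 5 + eval (forgetLast w) G = 0 := by
  obtain ⟨b, hb⟩ := eval_eq_mul_of_eval_conic_eq_zero_two hF φ fun s t => (h s t).1
  obtain ⟨ℓ, hℓ⟩ := eval_eq_mul_of_eval_conic_eq_zero_three hG φ fun s t => (h s t).2
  by_cases hb0 : b = 0
  · have hker : 2 ≤ Module.finrank ℂ (LinearMap.ker ℓ) := by
      have h1 := ℓ.finrank_range_add_finrank_ker
      have h2 := Submodule.finrank_le (LinearMap.range ℓ)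
      simp at h1 h2
      omega
    obtain ⟨T, hT, hT2⟩ := Submodule.exists_le_finrank_eq _ hker
    refine exists_plane_of_line (L := T.map φ) ?_ ?_
    · rw [← hT2]
      exact (Submodule.equivMapOfInjective φ hφ T).finrank_eq.symm
    · rintro _ ⟨y, hy, rfl⟩
      rw [hb, hℓ, hb0, LinearMap.mem_ker.mp (hT hy)]
      simp
  · refine exists_plane_of_graph hφ (-b⁻¹ • ℓ) fun y => ?_
    rw [hb, hℓ]
    simp
    field_simp
    ring

theorem cubic_contains_plane_iff_lines_surface_contains_line_or_conic
    (F G : MvPolynomial (Fin 5) ℂ) (hF0 : F ≠ 0)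
    (hF : F.IsHomogeneous 2) (hG : G.IsHomogeneous 3)
    (P : MvPolynomial (Fin 6) ℂ)
    (hP : P = rename Fin.castSucc F * X (5 : Fin 6) + rename Fin.castSucc G)
    (hPirr : Irreducible P) :
    (∃ W : Submodule ℂ (Fin 6 → ℂ), Module.finrank ℂ W = 3 ∧
        ∀ w ∈ W, eval w P = 0) ↔
    ((∃ L : Submodule ℂ (Fin 5 → ℂ), Module.finrank ℂ L = 2 ∧
        ∀ x ∈ L, eval x F = 0 ∧ eval x G = 0) ∨
      (∃ W : Submodule ℂ (Fin 5 → ℂ), Module.finrank ℂ W = 3 ∧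
        ∃ q : QuadraticForm ℂ W, q ≠ 0 ∧
          ∀ w : W, q w = 0 →
            eval (w : Fin 5 → ℂ) F = 0 ∧ eval (w : Fin 5 → ℂ) G = 0)) := by
  have hPeval : ∀ x, eval x P = eval (forgetLast x) F * x 5 + eval (forgetLast x) G := fun x => by
    rw [hP]
    exact eval_rename_castSucc_mul_X_add F G x
  simp only [hPeval]
  constructor
  · rintro ⟨W, hW, hWP⟩
    by_cases hp : Pi.single 5 1 ∈ W
    · refine Or.inl ⟨W.map forgetLast, by have := finrank_map_forgetLast_of_mem hp; omega, ?_⟩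
      rintro _ ⟨w, hw, rfl⟩
      have h0 := hWP w hw
      have h1 := hWP _ (W.add_mem hw hp)
      rw [map_add, forgetLast_single, add_zero, Pi.add_apply, Pi.single_eq_same] at h1
      have hFw : eval (forgetLast w) F = 0 := by linear_combination h1 - h0
      exact ⟨hFw, by linear_combination h0 - w 5 * hFw⟩
    · have hrank := finrank_map_forgetLast_of_notMem hp
      have hFG : ∀ x ∈ W.map forgetLast, eval x F = 0 → eval x G = 0 := by
        rintro _ ⟨w, hw, rfl⟩ hFw
        linear_combination hWP w hw - w 5 * hFw
      obtain ⟨Q, hQ⟩ := exists_quadraticForm_eq_eval hF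
      by_cases hq : Q.comp (W.map forgetLast).subtype = 0
      · obtain ⟨T, hT, hT2⟩ :=
          (W.map forgetLast).exists_le_finrank_eq (n := 2) (by omega)
        refine Or.inl ⟨T, hT2, fun x hx => ?_⟩
        have hFx : eval x F = 0 := (hQ x).symm.trans (DFunLike.congr_fun hq ⟨x, hT hx⟩)
        exact ⟨hFx, hFG x (hT hx) hFx⟩
      · refine Or.inr ⟨W.map forgetLast, by omega, _, hq, fun w hw => ?_⟩
        have hFw : eval (w : Fin 5 → ℂ) F = 0 := (hQ w).symm.trans hw
        exact ⟨hFw, hFG w w.2 hFw⟩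
  · rintro (⟨L, hL, h⟩ | ⟨W, hW, q, -, h⟩)
    · exact exists_plane_of_line hL h
    · rcases QuadraticForm.exists_isotropic_plane_or_conic hW q with
        ⟨ψ, hψ, hq⟩ | ⟨ψ, hψ, hq⟩
      · refine exists_plane_of_line (L := LinearMap.range (W.subtype ∘ₗ ψ)) ?_ ?_
        · rw [LinearMap.finrank_range_of_inj (Subtype.val_injective.comp hψ)]
          simp
        · rintro _ ⟨y, rfl⟩
          exact h _ (hq y)
      · exact exists_plane_of_conic hF hG (φ := W.subtype ∘ₗ ψ) (Subtype.val_injective.comp hψ)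
          fun s t => h _ (hq s t)
end

section
/- Identify ℙ⁵(ℂ) with the projectivization ℙ(S) of the 6-dimensional space S of symmetric 3×3 complex matrices, and let V = {[v vᵀ] : v ∈ ℂ³ \ {0}} be the Veronese surface. Then the union of all projective lines through two distinct points of V equals {[A] ∈ ℙ(S) : det A = 0}; in particular the chord variety of V is a cubic hypersurface in ℙ⁵. Moreover this cubic contains planes: for every nonzero u ∈ ℂ³, the set {A ∈ S : A u = 0} is a 3-dimensional linear subspace of S all of whose nonzero elements satisfy det A = 0, so its projectivization is a plane contained in the chord variety. -/
open Matrix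

/-- A symmetric matrix over a field of characteristic not two is congruent to a diagonal matrix. -/
theorem Matrix.IsSymm.exists_eq_transpose_mul_diagonal_mul {K : Type*} [Field K]
    [Invertible (2 : K)] {n : ℕ} {A : Matrix (Fin n) (Fin n) K} (hA : A.IsSymm) :
    ∃ (P : Matrix (Fin n) (Fin n) K) (d : Fin n → K),
      IsUnit P ∧ A = Pᵀ * diagonal d * P := by
  have hB : A.toBilin'.IsSymm := Matrix.isSymm_toBilin'_iff_isSymm.2 hA
  obtain ⟨b₀, hb₀⟩ := LinearMap.BilinForm.exists_orthogonal_basis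
    (LinearMap.BilinForm.isSymm_iff.1 hB)
  let e : Fin (Module.finrank K (Fin n → K)) ≃ Fin n := finCongr (Module.finrank_fin_fun K)
  let b := b₀.reindex e
  refine ⟨b.toMatrix (Pi.basisFun K (Fin n)), fun i => A.toBilin' (b i) (b i), ?_, ?_⟩
  · have := b.invertibleToMatrix (Pi.basisFun K (Fin n))
    exact isUnit_of_invertible _
  · have hdiag : diagonal (fun i => A.toBilin' (b i) (b i)) =
        LinearMap.BilinForm.toMatrix b A.toBilin' := by
      ext i j
      rw [LinearMap.BilinForm.toMatrix_apply]
      rcases eq_or_ne i j with rfl | hij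
      · simp
      · rw [diagonal_apply_ne _ hij]
        have h := hb₀ (e.symm.injective.ne hij)
        simpa [b] using h.symm
    rw [hdiag, LinearMap.BilinForm.toMatrix_mul_basis_toMatrix,
      LinearMap.BilinForm.toMatrix_basisFun, LinearMap.BilinForm.toMatrix'_toBilin']

theorem Matrix.transpose_mul_diagonal_mul_eq_sum {K n : Type*} [CommRing K] [Fintype n]
    [DecidableEq n] (P : Matrix n n K) (d : n → K) :
    Pᵀ * diagonal d * P = ∑ i, d i • vecMulVec (P i) (P i) := by
  ext j k
  rw [mul_apply]
  simp only [mul_diagonal, transpose_apply, sum_apply, smul_apply, vecMulVec_apply, smul_eq_mul]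
  exact Finset.sum_congr rfl fun i _ => by ring

/-- A singular symmetric `3 × 3` matrix is a combination of the squares of two independent
vectors. -/
theorem Matrix.IsSymm.exists_eq_smul_vecMulVec_add_of_det_eq_zero {K : Type*} [Field K]
    [Invertible (2 : K)] {A : Matrix (Fin 3) (Fin 3) K} (hA : A.IsSymm) (hdet : A.det = 0) :
    ∃ (v w : Fin 3 → K) (c d : K), LinearIndependent K ![v, w] ∧
      A = c • vecMulVec v v + d • vecMulVec w w := by
  obtain ⟨P, d, hP, rfl⟩ := hA.exists_eq_transpose_mul_diagonal_mul
  have hP' : P.det ≠ 0 := ((isUnit_iff_isUnit_det P).1 hP).ne_zero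
  have hli : LinearIndependent K P.row := linearIndependent_rows_iff_isUnit.2 hP
  have hpair {i j : Fin 3} (hij : i ≠ j) : LinearIndependent K ![P i, P j] := by
    have h := hli.comp ![i, j] (by
      intro a b
      fin_cases a <;> fin_cases b <;> simp [hij, hij.symm])
    convert h using 1
    ext a
    fin_cases a <;> rfl
  obtain ⟨i, hi⟩ : ∃ i, d i = 0 := by
    simpa [det_mul, det_transpose, det_diagonal, hP', Finset.prod_eq_zero_iff] using hdet
  rw [transpose_mul_diagonal_mul_eq_sum, Fin.sum_univ_three]
  fin_cases i
  · exact ⟨P 1, P 2, d 1, d 2, hpair (by decide), by simp_all⟩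
  · exact ⟨P 0, P 2, d 0, d 2, hpair (by decide), by simp_all⟩
  · exact ⟨P 0, P 1, d 0, d 1, hpair (by decide), by simp_all⟩

theorem Matrix.det_smul_vecMulVec_add_smul_vecMulVec {K : Type*} [CommRing K]
    (v w : Fin 3 → K) (c d : K) :
    (c • vecMulVec v v + d • vecMulVec w w).det = 0 := by
  simp only [det_fin_three, add_apply, smul_apply, vecMulVec_apply, smul_eq_mul]
  ring

/-- The symmetric `3 × 3` matrix with given upper triangular entries. -/
def symmOfUpper (K : Type*) [CommRing K] : (Fin 6 → K) →ₗ[K] Matrix (Fin 3) (Fin 3) K where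
  toFun x := !![x 0, x 1, x 2; x 1, x 3, x 4; x 2, x 4, x 5]
  map_add' x y := by ext i j; fin_cases i <;> fin_cases j <;> rfl
  map_smul' c x := by ext i j; fin_cases i <;> fin_cases j <;> rfl

theorem symmOfUpper_injective (K : Type*) [CommRing K] : Function.Injective (symmOfUpper K) := by
  intro x y h
  have h' (i j : Fin 3) : symmOfUpper K x i j = symmOfUpper K y i j := by rw [h]
  ext i
  fin_cases i
  · exact h' 0 0
  · exact h' 0 1
  · exact h' 0 2
  · exact h' 1 1
  · exact h' 1 2
  · exact h' 2 2

theorem mem_range_symmOfUpper {K : Type*} [CommRing K] {A : Matrix (Fin 3) (Fin 3) K} :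
    A ∈ LinearMap.range (symmOfUpper K) ↔ A.IsSymm := by
  constructor
  · rintro ⟨x, rfl⟩
    ext i j
    fin_cases i <;> fin_cases j <;> rfl
  · intro hA
    refine ⟨![A 0 0, A 0 1, A 0 2, A 1 1, A 1 2, A 2 2], ?_⟩
    ext i j
    fin_cases i <;> fin_cases j <;> first | rfl | exact hA.apply _ _

/-- Symmetric matrices act transitively on the image of a nonzero vector. -/
theorem Matrix.exists_isSymm_mulVec_eq {K n : Type*} [Field K] [Fintype n] {u : n → K}
    (hu : u ≠ 0) (y : n → K) : ∃ A : Matrix n n K, A.IsSymm ∧ A *ᵥ u = y := by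
  classical
  obtain ⟨i, hi⟩ := Function.ne_iff.1 hu
  obtain ⟨w, hw⟩ : ∃ w : n → K, w ⬝ᵥ u = 1 := ⟨Pi.single i (u i)⁻¹, by simpa using inv_mul_cancel₀ hi⟩
  refine ⟨vecMulVec y w + vecMulVec w y - (y ⬝ᵥ u) • vecMulVec w w, ?_, ?_⟩
  · ext j k
    simp only [transpose_apply, sub_apply, add_apply, smul_apply, vecMulVec_apply, smul_eq_mul]
    ring
  · ext j
    simp [sub_mulVec, add_mulVec, smul_mulVec, vecMulVec_mulVec, hw, mul_comm]

/-- The symmetric `3 × 3` matrices annihilating `u`. -/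
def symmAnnihilator {K : Type*} [CommRing K] (u : Fin 3 → K) :
    Submodule K (Matrix (Fin 3) (Fin 3) K) :=
  (LinearMap.ker ((mulVecBilin K K).flip u ∘ₗ symmOfUpper K)).map (symmOfUpper K)

theorem mem_symmAnnihilator {K : Type*} [CommRing K] {u : Fin 3 → K}
    {A : Matrix (Fin 3) (Fin 3) K} : A ∈ symmAnnihilator u ↔ A.IsSymm ∧ A *ᵥ u = 0 := by
  rw [← mem_range_symmOfUpper]
  constructor
  · rintro ⟨x, hx, rfl⟩
    exact ⟨⟨x, rfl⟩, hx⟩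
  · rintro ⟨⟨x, rfl⟩, hx⟩
    exact ⟨x, hx, rfl⟩

theorem finrank_symmAnnihilator {K : Type*} [Field K] {u : Fin 3 → K} (hu : u ≠ 0) :
    Module.finrank K (symmAnnihilator u) = 3 := by
  rw [symmAnnihilator, ← (Submodule.equivMapOfInjective _ (symmOfUpper_injective K) _).finrank_eq]
  set f := (mulVecBilin K K).flip u ∘ₗ symmOfUpper K
  have hf : LinearMap.range f = ⊤ := by
    rw [LinearMap.range_eq_top]
    intro y
    obtain ⟨A, hA, rfl⟩ := exists_isSymm_mulVec_eq hu y
    obtain ⟨x, rfl⟩ := mem_range_symmOfUpper.2 hA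
    exact ⟨x, rfl⟩
  have h := f.finrank_range_add_finrank_ker
  rw [hf, finrank_top, Module.finrank_fin_fun, Module.finrank_fin_fun] at h
  omega


/- STATEMENT 11: the chord variety of the Veronese surface V = {[v vᵀ]} in the
projectivized space of symmetric 3×3 complex matrices is the cubic hypersurface
{det = 0}, and for every nonzero u ∈ ℂ³ the space {A symmetric : A u = 0} is a
3-dimensional linear subspace contained in this cubic (a plane in the chord variety). -/

theorem veronese_chord_variety_is_determinantal_cubic_and_contains_planes :
    (∀ A : Matrix (Fin 3) (Fin 3) ℂ, A.IsSymm → A ≠ 0 →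
      (A.det = 0 ↔
        ∃ (v w : Fin 3 → ℂ) (c d : ℂ),
          LinearIndependent ℂ ![v, w] ∧
          A = c • vecMulVec v v + d • vecMulVec w w)) ∧
    (∀ u : Fin 3 → ℂ, u ≠ 0 →
      ∃ Wu : Submodule ℂ (Matrix (Fin 3) (Fin 3) ℂ),
        (Wu : Set (Matrix (Fin 3) (Fin 3) ℂ)) =
          {A : Matrix (Fin 3) (Fin 3) ℂ | A.IsSymm ∧ A *ᵥ u = 0} ∧
        Module.finrank ℂ Wu = 3 ∧
        ∀ A ∈ Wu, A.det = 0) := by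
  refine ⟨fun A hA _ => ⟨hA.exists_eq_smul_vecMulVec_add_of_det_eq_zero, ?_⟩, fun u hu =>
    ⟨symmAnnihilator u, Set.ext fun A => mem_symmAnnihilator, finrank_symmAnnihilator hu,
      fun A hA => exists_mulVec_eq_zero_iff.1 ⟨u, hu, (mem_symmAnnihilator.1 hA).2⟩⟩⟩
  rintro ⟨v, w, c, d, -, rfl⟩
  exact det_smul_vecMulVec_add_smul_vecMulVec v w c d
end

section
/- Let ν̃ : ℂ² → ℂ⁶ be given by ν̃(s,t) = (s⁵, s⁴t, s³t², s²t³, st⁴, t⁵), parametrizing the affine cone over the degree-5 rational normal curve Γ ⊂ ℙ⁵. Then the set of homogeneous cubic polynomials F ∈ ℂ[X₀,…,X₅] such that every first partial derivative ∂F/∂Xᵢ vanishes at ν̃(s,t) for all (s,t) ∈ ℂ² (i.e. the cubics singular at every point of Γ) is a ℂ-vector subspace of dimension exactly 4 of the space of homogeneous cubics. -/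
/- STATEMENT 13: the cubics in ℙ⁵ singular at every point of the degree-5 rational
normal curve form a vector subspace of dimension exactly 4. -/

open MvPolynomial

/-- Parametrization of the affine cone over the degree-5 rational normal curve. -/
noncomputable def nu5 (s t : ℂ) : Fin 6 → ℂ := ![s^5, s^4*t, s^3*t^2, s^2*t^3, s*t^4, t^5]

theorem pderiv_pderiv_comm {R σ : Type*} [CommRing R] (i j : σ) (F : MvPolynomial σ R) :
    pderiv i (pderiv j F) = pderiv j (pderiv i F) := by
  classical
  have h : ⁅(pderiv i : Derivation R (MvPolynomial σ R) (MvPolynomial σ R)),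
      (pderiv j : Derivation R (MvPolynomial σ R) (MvPolynomial σ R))⁆ = 0 := by
    ext k : 1
    simp [Derivation.commutator_apply, pderiv_X, Pi.single_apply, apply_ite]
  have h' := congrArg (fun D : Derivation R (MvPolynomial σ R) (MvPolynomial σ R) => D F) h
  simpa [Derivation.commutator_apply, sub_eq_zero] using h'

/-- The constant term of a third partial derivative, as a linear functional. -/
noncomputable def thirdDerivAtZero {σ : Type*} (i j k : σ) : MvPolynomial σ ℂ →ₗ[ℂ] ℂ :=
  lcoeff ℂ 0 ∘ₗ (pderiv k).toLinearMap ∘ₗ (pderiv j).toLinearMap ∘ₗ (pderiv i).toLinearMap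

theorem thirdDerivAtZero_apply {σ : Type*} (i j k : σ) (F : MvPolynomial σ ℂ) :
    thirdDerivAtZero i j k F = coeff 0 (pderiv k (pderiv j (pderiv i F))) := rfl

theorem thirdDerivAtZero_swap_left {σ : Type*} (i j k : σ) (F : MvPolynomial σ ℂ) :
    thirdDerivAtZero i j k F = thirdDerivAtZero j i k F := by
  simp only [thirdDerivAtZero_apply, pderiv_pderiv_comm i j]

theorem thirdDerivAtZero_swap_right {σ : Type*} (i j k : σ) (F : MvPolynomial σ ℂ) :
    thirdDerivAtZero i j k F = thirdDerivAtZero i k j F := by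
  simp only [thirdDerivAtZero_apply, pderiv_pderiv_comm k j]

/-- The second-order Taylor formula for the gradient of a cubic form. -/
theorem sum_thirdDerivAtZero_mul {σ : Type*} [Fintype σ] {F : MvPolynomial σ ℂ}
    (hF : F.IsHomogeneous 3) (i : σ) :
    ∑ j, ∑ k, C (thirdDerivAtZero i j k F) * (X j * X k) = 2 • pderiv i F := by
  have h1 : (pderiv i F).IsHomogeneous 2 := hF.pderiv
  have h2 (j : σ) : (pderiv j (pderiv i F)).IsHomogeneous 1 := h1.pderiv
  rw [← h1.sum_X_mul_pderiv]
  refine Finset.sum_congr rfl fun j _ => ?_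
  conv_rhs => rw [← one_smul ℕ (pderiv j (pderiv i F)), ← (h2 j).sum_X_mul_pderiv]
  rw [Finset.mul_sum]
  refine Finset.sum_congr rfl fun k _ => ?_
  have h3 : (pderiv k (pderiv j (pderiv i F))).IsHomogeneous 0 := (h2 j).pderiv
  rw [← totalDegree_zero_iff_isHomogeneous, totalDegree_eq_zero_iff_eq_C] at h3
  rw [thirdDerivAtZero_apply, ← h3]
  ring

/-- A cubic form is determined by its third partial derivatives. -/
theorem eq_zero_of_thirdDerivAtZero {σ : Type*} [Fintype σ] {F : MvPolynomial σ ℂ}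
    (hF : F.IsHomogeneous 3) (h : ∀ i j k, thirdDerivAtZero i j k F = 0) : F = 0 := by
  have h1 (i : σ) : pderiv i F = 0 := by
    have := sum_thirdDerivAtZero_mul hF i
    simpa [h] using this.symm
  have := hF.sum_X_mul_pderiv
  simpa [h1] using this.symm

/-- The cubic forms singular along the cone over the rational normal quintic. -/
noncomputable def singularCubics : Submodule ℂ (MvPolynomial (Fin 6) ℂ) where
  carrier := {F | F.IsHomogeneous 3 ∧
    ∀ (s t : ℂ) (i : Fin 6), eval (nu5 s t) (pderiv i F) = 0}
  add_mem' := fun ha hb => ⟨ha.1.add hb.1, fun s t i => by simp [ha.2, hb.2]⟩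
  zero_mem' := ⟨isHomogeneous_zero _ _ _, by simp⟩
  smul_mem' := fun c F hF => ⟨(homogeneousSubmodule (Fin 6) ℂ 3).smul_mem c hF.1,
    fun s t i => by simp [hF.2]⟩

theorem nu5_one (t : ℂ) (i : Fin 6) : nu5 1 t i = t ^ (i : ℕ) := by
  fin_cases i <;> simp [nu5]

/-- Along the curve, the weight components of the gradient of a singular cubic vanish. -/
theorem sum_thirdDerivAtZero_weight {F : MvPolynomial (Fin 6) ℂ} (hF : F ∈ singularCubics)
    (i : Fin 6) (w : ℕ) :
    ∑ j : Fin 6, ∑ k : Fin 6,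
      (if w = (j : ℕ) + k then thirdDerivAtZero i j k F else 0) = 0 := by
  have hp : ∑ j : Fin 6, ∑ k : Fin 6,
      Polynomial.C (thirdDerivAtZero i j k F) * Polynomial.X ^ ((j : ℕ) + k) = 0 := by
    refine Polynomial.funext fun t => ?_
    have h := congrArg (eval (nu5 1 t)) (sum_thirdDerivAtZero_mul hF.1 i)
    simp only [map_sum, map_mul, eval_C, eval_X, nu5_one, map_nsmul, hF.2, ← pow_add] at h
    simpa [Polynomial.eval_finsetSum] using h
  have h := congrArg (fun p => Polynomial.coeff p w) hp
  simpa only [Polynomial.finsetSum_coeff, Polynomial.coeff_C_mul_X_pow,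
    Polynomial.coeff_zero] using h

set_option maxHeartbeats 4000000 in
theorem symmetric_tensor_eq_zero {a : Fin 6 → Fin 6 → Fin 6 → ℂ}
    (h12 : ∀ i j k, a i j k = a j i k) (h23 : ∀ i j k, a i j k = a i k j)
    (hw : ∀ (i : Fin 6) (w : ℕ), ∑ j : Fin 6, ∑ k : Fin 6,
      (if w = (j : ℕ) + k then a i j k else 0) = 0)
    (h6 : a 2 2 2 = 0) (h7 : a 0 2 5 = 0) (h8 : a 0 3 5 = 0) (h9 : a 3 3 3 = 0)
    (i j k : Fin 6) : a i j k = 0 := by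
  wlog hij : i ≤ j generalizing i j k
  · rw [h12]
    exact this j i k (le_of_not_ge hij)
  wlog hjk : j ≤ k generalizing i j k
  · rw [h23]
    rcases le_total i k with h | h
    · exact this i k j h (le_of_not_ge hjk)
    · rw [h12]
      exact this k i j h hij
  obtain ⟨n, hn⟩ : ∃ n : ℕ, n = i + j + k := ⟨_, rfl⟩
  have e0 := hw 0 n
  have e1 := hw 1 (n - 1)
  have e2 := hw 2 (n - 2)
  have e3 := hw 3 (n - 3)
  have e4 := hw 4 (n - 4)
  have e5 := hw 5 (n - 5)
  clear hw
  simp only [Fin.sum_univ_six] at e0 e1 e2 e3 e4 e5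
  have hn' : n ≤ 15 := by omega
  interval_cases n <;> simp [h12, h23] at e0 e1 e2 e3 e4 e5 <;> clear h12 h23 <;>
    fin_cases i <;> fin_cases j <;>
    first
    | (exfalso; revert hij; decide)
    | (fin_cases k <;>
        first
        | (exfalso; revert hn; decide)
        | (exfalso; revert hjk; decide)
        | (dsimp only [Fin.reduceFinMk, Fin.zero_eta, Fin.mk_one]; grind only))

/-- The maximal minors of the `3 × 4` Hankel matrix `(X (i + j))`. -/
noncomputable def hankelMinor (m : Fin 4) : MvPolynomial (Fin 6) ℂ :=
  Matrix.det (Matrix.of fun i j : Fin 3 =>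
    X ⟨(i : ℕ) + (m.succAbove j : ℕ), by omega⟩)

theorem hankelMinor_mem (m : Fin 4) : hankelMinor m ∈ singularCubics := by
  refine ⟨?_, fun s t i => ?_⟩
  · rw [hankelMinor, Matrix.det_apply]
    refine IsHomogeneous.sum _ _ _ fun σ _ => ?_
    rw [Units.smul_def, ← Int.cast_smul_eq_zsmul ℂ]
    refine (homogeneousSubmodule (Fin 6) ℂ 3).smul_mem _ ?_
    exact IsHomogeneous.prod Finset.univ _ (fun _ => 1) fun i _ => isHomogeneous_X ℂ _
  · rw [hankelMinor, Matrix.det_fin_three]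
    fin_cases m <;> fin_cases i <;>
      simp [pderiv_X, nu5, Fin.succAbove, Fin.lt_def] <;> ring

/-- The coordinates on the space of singular cubics. -/
noncomputable def singularCubicsCoord : singularCubics →ₗ[ℂ] (Fin 4 → ℂ) :=
  LinearMap.pi ![thirdDerivAtZero 3 3 3, thirdDerivAtZero 0 3 5,
    thirdDerivAtZero 0 2 5, thirdDerivAtZero 2 2 2] ∘ₗ singularCubics.subtype

theorem singularCubicsCoord_injective : Function.Injective singularCubicsCoord := by
  rw [injective_iff_map_eq_zero]
  intro F hF
  have h (m : Fin 4) := congrFun hF m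
  refine Subtype.ext (eq_zero_of_thirdDerivAtZero F.2.1 ?_)
  exact symmetric_tensor_eq_zero (fun i j k => thirdDerivAtZero_swap_left i j k F.1)
    (fun i j k => thirdDerivAtZero_swap_right i j k F.1)
    (sum_thirdDerivAtZero_weight F.2) (h 3) (h 2) (h 1) (h 0)

theorem singularCubicsCoord_hankelMinor (m : Fin 4) :
    singularCubicsCoord ⟨hankelMinor m, hankelMinor_mem m⟩ =
      Pi.single m (![-6, 1, 1, -6] m) := by
  ext n
  fin_cases m <;> fin_cases n <;>
    simp [singularCubicsCoord, thirdDerivAtZero_apply, hankelMinor, Matrix.det_fin_three,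
      pderiv_X, Fin.succAbove, Fin.lt_def] <;> norm_num

theorem singularCubicsCoord_surjective : Function.Surjective singularCubicsCoord := by
  intro c
  refine ⟨∑ m, (c m * (![-6, 1, 1, -6] m)⁻¹) • ⟨hankelMinor m, hankelMinor_mem m⟩, ?_⟩
  ext n
  simp only [map_sum, map_smul, singularCubicsCoord_hankelMinor]
  fin_cases n <;> simp [Fin.sum_univ_four]

theorem cubics_singular_along_quintic_rnc_form_fourdim_space :
    ∃ V : Submodule ℂ (MvPolynomial (Fin 6) ℂ),
      (V : Set (MvPolynomial (Fin 6) ℂ)) =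
        {F : MvPolynomial (Fin 6) ℂ | F.IsHomogeneous 3 ∧
          ∀ (s t : ℂ) (i : Fin 6), eval (nu5 s t) (pderiv i F) = 0} ∧
      Module.finrank ℂ V = 4 := by
  refine ⟨singularCubics, rfl, ?_⟩
  rw [(LinearEquiv.ofBijective singularCubicsCoord
    ⟨singularCubicsCoord_injective, singularCubicsCoord_surjective⟩).finrank_eq]
  simp
end
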